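/- arXiv:1811.05457 — 2 statements merged into one kernel-verified Lean document; each statement's English description precedes it below -/
import Mathlib

section
/- Let 𝒪 ⊂ ℝ^{m−1} × ℝ^n be open, ψ ∈ C(𝒪, ℝ), w = (w₂,…,w_m) ∈ C(𝒪, ℝ^{m−1}), and suppose there is a family (ψ_ε)_{ε∈(0,1)} ⊂ C¹(𝒪, ℝ) such that for every compact K ⊂ 𝒪 and every j = 2,…,m, ψ_ε → ψ and D_j^{ψ_ε}ψ_ε → w_j uniformly on K as ε → 0⁺. Then ψ ∈ h^{1/2}_{loc}(𝒪): for every compact K ⊂ 𝒪, lim_{r→0⁺} sup { |ψ(A) − ψ(A')| / |A − A'|^{1/2} : A, A' ∈ K, 0 < |A − A'| ≤ r } = 0, where |·| is the Euclidean norm on ℝ^{m+n−1}. -/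
noncomputable section

open Set Filter Topology MeasureTheory

namespace Carnot

/-- Euclidean norm on `Fin d → ℝ`. -/
def enorm {d : ℕ} (x : Fin d → ℝ) : ℝ := Real.sqrt (∑ i, (x i) ^ 2)

/-- The underlying set of the Carnot group `G = ℝ^m × ℝ^n` of class `𝓑`. -/
abbrev G (m n : ℕ) := (Fin m → ℝ) × (Fin n → ℝ)

/-- Points of the normal complement `W`, identified with `ℝ^(m-k) × ℝ^n`. -/
abbrev W (m n k : ℕ) := (Fin (m - k) → ℝ) × (Fin n → ℝ)

/-- The group law of the Carnot group of class `𝓑` associated with the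
skew-symmetric matrices `b s`:
`(x,y)·(x',y') = (x + x', y + y' + ½⟨Bx,x'⟩)`. -/
def gmul {m n : ℕ} (b : Fin n → Matrix (Fin m) (Fin m) ℝ) (P Q : G m n) : G m n :=
  (P.1 + Q.1, fun s => P.2 s + Q.2 s + (1 / 2) * ∑ i, ∑ j, b s i j * P.1 j * Q.1 i)

/-- The group inverse `(x,y)⁻¹ = (-x,-y)`. -/
def ginv {m n : ℕ} (P : G m n) : G m n := (-P.1, -P.2)

/-- The homogeneous quasi-norm `N(x,y) = |x| + |y|^(1/2)`. -/
def qnorm {m n : ℕ} (P : G m n) : ℝ := enorm P.1 + Real.sqrt (enorm P.2)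

/-- Open ball for the quasi-norm: `U(P,r) = {Q : N(P⁻¹·Q) < r}`. -/
def ball (m n : ℕ) (b : Fin n → Matrix (Fin m) (Fin m) ℝ) (P : G m n) (r : ℝ) : Set (G m n) :=
  {Q | qnorm (gmul b (ginv P) Q) < r}

/-- The embedding `i : ℝ^(m-k) × ℝ^n → G`, `i(a,α) = (0,…,0,a,α)`. -/
def embW (m n k : ℕ) (A : W m n k) : G m n :=
  (fun j => if h : (j : ℕ) < k then 0 else A.1 ⟨(j : ℕ) - k, by have := j.isLt; omega⟩, A.2)

/-- The embedding of `ℝ^k` as the horizontal subgroup `H`, `v ↦ (v,0,…,0)`. -/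
def embH (m n k : ℕ) (v : Fin k → ℝ) : G m n :=
  (fun j => if h : (j : ℕ) < k then v ⟨(j : ℕ), h⟩ else 0, 0)

/-- The graph map `Φ(A) = i(A)·φ̂(A)`. -/
def graphMap (m n k : ℕ) (b : Fin n → Matrix (Fin m) (Fin m) ℝ)
    (φ : W m n k → Fin k → ℝ) (A : W m n k) : G m n :=
  gmul b (embW m n k A) (embH m n k (φ A))

/-- `N(i(A)⁻¹·i(B))`. -/
def dW (m n k : ℕ) (b : Fin n → Matrix (Fin m) (Fin m) ℝ) (A B : W m n k) : ℝ :=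
  qnorm (gmul b (ginv (embW m n k A)) (embW m n k B))

/-- The graph quasi-distance `σ_φ(A,B) = N(φ̂(A)⁻¹·i(A)⁻¹·i(B)·φ̂(A))`. -/
def sigma (m n k : ℕ) (b : Fin n → Matrix (Fin m) (Fin m) ℝ)
    (φ : W m n k → Fin k → ℝ) (A B : W m n k) : ℝ :=
  qnorm (gmul b (gmul b (gmul b (ginv (embH m n k (φ A))) (ginv (embW m n k A)))
    (embW m n k B)) (embH m n k (φ A)))

/-- The matrix `M` satisfies the uniform intrinsic differentiability condition of `φ`
at `A₀ ∈ 𝒪`. -/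
def UID (m n k : ℕ) (b : Fin n → Matrix (Fin m) (Fin m) ℝ) (O : Set (W m n k))
    (φ : W m n k → Fin k → ℝ) (A₀ : W m n k) (M : Matrix (Fin k) (Fin (m - k)) ℝ) : Prop :=
  ∀ ε > 0, ∃ r > 0, ∀ A ∈ O, ∀ B ∈ O,
    dW m n k b A₀ A < r → dW m n k b A B < r → 0 < dW m n k b A B →
    enorm (fun j => φ B j - φ A j - ∑ i, M j i * (B.1 i - A.1 i)) ≤ ε * sigma m n k b φ A B

/-- `f : U → ℝ^k` is of class `C¹_G` with (continuous) horizontal Jacobian `gradf`. -/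
def C1G (m n k : ℕ) (b : Fin n → Matrix (Fin m) (Fin m) ℝ) (U : Set (G m n))
    (f : G m n → Fin k → ℝ) (gradf : G m n → Matrix (Fin k) (Fin m) ℝ) : Prop :=
  ContinuousOn f U ∧ ContinuousOn gradf U ∧
  ∀ P ∈ U, ∀ ε > 0, ∃ r > 0, ∀ Q ∈ U,
    qnorm (gmul b (ginv P) Q) < r →
    enorm (fun j => f Q j - f P j - ∑ i, gradf P j i * (Q.1 i - P.1 i)) ≤
      ε * qnorm (gmul b (ginv P) Q)

/-- The square block `M₁(Q) = (X_i f_j(Q))_{j,i=1,…,k}` of the horizontal Jacobian. -/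
def M1 (m n k : ℕ) (hk : k ≤ m) (gradf : G m n → Matrix (Fin k) (Fin m) ℝ) (Q : G m n) :
    Matrix (Fin k) (Fin k) ℝ :=
  Matrix.of fun j i => gradf Q j (Fin.castLE hk i)

/-- The block `M₂(Q) = (X_{k+i} f_j(Q))_{j=1,…,k; i=1,…,m-k}` of the horizontal Jacobian. -/
def M2 (m n k : ℕ) (gradf : G m n → Matrix (Fin k) (Fin m) ℝ) (Q : G m n) :
    Matrix (Fin k) (Fin (m - k)) ℝ :=
  Matrix.of fun j i => gradf Q j ⟨k + (i : ℕ), by have := i.isLt; omega⟩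

/-! ### The codimension-one case `k = 1` -/

/-- The index of the variable `x_{j+1}`, `j ∈ {2,…,m}`, inside `Fin m`
(recall that points of `ℝ^{m-1} × ℝ^n` are written `(x₂,…,x_m,y₁,…,y_n)`). -/
def idx1 (m : ℕ) (i : Fin (m - 1)) : Fin m := ⟨(i : ℕ) + 1, by have := i.isLt; omega⟩

/-- Scalar version of `C1G`: `f : U → ℝ` of class `C¹_G` with horizontal
gradient `∇_G f = (X₁f,…,X_mf)`. -/
def C1Gs (m n : ℕ) (b : Fin n → Matrix (Fin m) (Fin m) ℝ) (U : Set (G m n))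
    (f : G m n → ℝ) (gradf : G m n → Fin m → ℝ) : Prop :=
  ContinuousOn f U ∧ ContinuousOn gradf U ∧
  ∀ P ∈ U, ∀ ε > 0, ∃ r > 0, ∀ Q ∈ U,
    qnorm (gmul b (ginv P) Q) < r →
    |f Q - f P - ∑ i, gradf P i * (Q.1 i - P.1 i)| ≤ ε * qnorm (gmul b (ginv P) Q)

/-- `ψ : 𝒪 → ℝ` is uniformly intrinsically differentiable at `A₀` with intrinsic
gradient `g ∈ ℝ^{m-1}` (scalar version of `UID`). -/
def UIDs (m n : ℕ) (b : Fin n → Matrix (Fin m) (Fin m) ℝ) (O : Set (W m n 1))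
    (ψ : W m n 1 → ℝ) (A₀ : W m n 1) (g : Fin (m - 1) → ℝ) : Prop :=
  ∀ ε > 0, ∃ r > 0, ∀ A ∈ O, ∀ B ∈ O,
    dW m n 1 b A₀ A < r → dW m n 1 b A B < r → 0 < dW m n 1 b A B →
    |ψ B - ψ A - ∑ i, g i * (B.1 i - A.1 i)| ≤
      ε * sigma m n 1 b (fun A' _ => ψ A') A B

/-- The graph map `Φ(A) = i(A)·ψ̂(A)` for a scalar `ψ`. -/
def graphMapS (m n : ℕ) (b : Fin n → Matrix (Fin m) (Fin m) ℝ)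
    (ψ : W m n 1 → ℝ) (A : W m n 1) : G m n :=
  graphMap m n 1 b (fun A' _ => ψ A') A

/-- The intrinsic derivative `D_j^ψ ψ` of a (C¹) function `ψ : ℝ^{m-1} × ℝ^n → ℝ`:
`D_j^ψψ = ∂_{x_j}ψ + Σ_s (ψ b^s_{j1} + ½ Σ_l x_l b^s_{jl}) ∂_{y_s}ψ`. -/
def Dj (m n : ℕ) (h0 : 0 < m) (b : Fin n → Matrix (Fin m) (Fin m) ℝ)
    (ψ : W m n 1 → ℝ) (j : Fin (m - 1)) (A : W m n 1) : ℝ :=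
  fderiv ℝ ψ A ((Pi.single j 1 : Fin (m - 1) → ℝ), (0 : Fin n → ℝ)) +
    ∑ s, (ψ A * b s (idx1 m j) ⟨0, h0⟩ +
        (1 / 2) * ∑ l, A.1 l * b s (idx1 m j) (idx1 m l)) *
      fderiv ℝ ψ A ((0 : Fin (m - 1) → ℝ), (Pi.single s 1 : Fin n → ℝ))

/-- Euclidean norm on `ℝ^d × ℝ^e`. -/
def enormP {d e : ℕ} (P : (Fin d → ℝ) × (Fin e → ℝ)) : ℝ :=
  Real.sqrt (∑ i, (P.1 i) ^ 2 + ∑ s, (P.2 s) ^ 2)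

/-- Closed Euclidean ball in `ℝ^d × ℝ^e`. -/
def cballE {d e : ℕ} (A : (Fin d → ℝ) × (Fin e → ℝ)) (r : ℝ) :
    Set ((Fin d → ℝ) × (Fin e → ℝ)) :=
  {B | enormP (B - A) ≤ r}

/-- `ψ` is a broad* solution of `(D₂^ψψ,…,D_m^ψψ) = w` in `𝒪`: around every point
there are exponential maps of the vector fields `D_j^ψ` along which `ψ(γ(t)) − ψ(γ(0))`
is the integral of `w_j ∘ γ`. -/
def IsBroadStar (m n : ℕ) (h0 : 0 < m) (b : Fin n → Matrix (Fin m) (Fin m) ℝ)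
    (O : Set (W m n 1)) (ψ : W m n 1 → ℝ) (w : W m n 1 → Fin (m - 1) → ℝ) : Prop :=
  ∀ A ∈ O, ∃ δ₁ δ₂ : ℝ, 0 < δ₂ ∧ δ₂ < δ₁ ∧ cballE A δ₁ ⊆ O ∧
    ∀ j : Fin (m - 1), ∃ γ : ℝ → W m n 1 → W m n 1,
      ∀ B ∈ cballE A δ₂,
        (∀ t ∈ Set.Icc (-δ₂) δ₂, γ t B ∈ cballE A δ₁) ∧
        γ 0 B = B ∧
        (∀ h : Fin (m - 1), ∀ t ∈ Set.Icc (-δ₂) δ₂,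
          HasDerivAt (fun t' => (γ t' B).1 h) (if h = j then 1 else 0) t) ∧
        (∀ s : Fin n, ∀ t ∈ Set.Icc (-δ₂) δ₂,
          HasDerivAt (fun t' => (γ t' B).2 s)
            (ψ (γ t B) * b s (idx1 m j) ⟨0, h0⟩ +
              (1 / 2) * ∑ l, (γ t B).1 l * b s (idx1 m j) (idx1 m l)) t) ∧
        (∀ t ∈ Set.Icc (-δ₂) δ₂, ψ (γ t B) - ψ B = ∫ r in (0:ℝ)..t, w (γ r B) j)

section Characteristics

/-- The Picard-Lindelöf theorem, with the solution staying in the ball where the assumptions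
hold. -/
lemma exists_hasDerivWithinAt_mem_closedBall {F : Type*} [NormedAddCommGroup F] [NormedSpace ℝ F]
    [CompleteSpace F] {f : ℝ → F → F} {tmin tmax : ℝ} {t₀ : Icc tmin tmax} {x₀ : F}
    {a r L K : NNReal} (hf : IsPicardLindelof f t₀ x₀ a r L K) :
    ∃ α : ℝ → F, α t₀ = x₀ ∧ ∀ t ∈ Icc tmin tmax,
      HasDerivWithinAt α (f t (α t)) (Icc tmin tmax) t ∧ α t ∈ Metric.closedBall x₀ a := by
  have hx : x₀ ∈ Metric.closedBall x₀ (r : ℝ) := Metric.mem_closedBall_self r.2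
  obtain ⟨α, hα⟩ := ODE.FunSpace.exists_isFixedPt_next hf hx
  have hmem : ∀ t, α.compProj t ∈ Metric.closedBall x₀ (a : ℝ) :=
    fun t => α.compProj_mem_closedBall hf.mul_max_le
  refine ⟨α.compProj, by rw [ODE.FunSpace.compProj_val, ← hα, ODE.FunSpace.next_apply₀],
    fun t ht => ⟨?_, hmem t⟩⟩
  refine (ODE.hasDerivWithinAt_picard_Icc t₀.2 hf.continuousOn_uncurry
    α.continuous_compProj.continuousOn (fun t' _ => hmem t') x₀ ht).congr_of_mem ?_ ht
  intro t' ht'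
  nth_rw 1 [← hα]
  rw [ODE.FunSpace.compProj_of_mem ht', ODE.FunSpace.next_apply]

variable {E : Type*} [NormedAddCommGroup E] [NormedSpace ℝ E]

/-- On the box `A + t p + z q`, `|t| ≤ T`, `|z| ≤ a`, the function `f` is bounded by `M`, Lipschitz
in the direction `q`, and its derivative along the characteristic direction `p + f q` is
`η`-close to the constant `g`. -/
structure CharBox (f : E → ℝ) (A p q : E) (T a M η g : ℝ) : Prop where
  T_pos : 0 < T
  small : M * T ≤ a / 2
  diff : ∀ t z : ℝ, |t| ≤ T → |z| ≤ a → DifferentiableAt ℝ f (A + t • p + z • q)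
  bound : ∀ t z : ℝ, |t| ≤ T → |z| ≤ a → |f (A + t • p + z • q)| ≤ M
  lip : ∃ L : ℝ, ∀ t z : ℝ, |t| ≤ T → |z| ≤ a → |fderiv ℝ f (A + t • p + z • q) q| ≤ L
  along : ∀ t z : ℝ, |t| ≤ T → |z| ≤ a →
    |fderiv ℝ f (A + t • p + z • q) (p + f (A + t • p + z • q) • q) - g| ≤ η

namespace CharBox

variable {f : E → ℝ} {A p q : E} {T a M η g : ℝ}

lemma M_nonneg (h : CharBox f A p q T a M η g) (ha : 0 ≤ a) : 0 ≤ M :=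
  (abs_nonneg _).trans (h.bound 0 0 (by simpa using h.T_pos.le) (by simpa using ha))

lemma eta_nonneg (h : CharBox f A p q T a M η g) (ha : 0 ≤ a) : 0 ≤ η :=
  (abs_nonneg _).trans (h.along 0 0 (by simpa using h.T_pos.le) (by simpa using ha))

lemma exists_lipschitzOnWith (h : CharBox f A p q T a M η g) :
    ∃ L : NNReal, ∀ t, |t| ≤ T →
      LipschitzOnWith L (fun z : ℝ => f (A + t • p + z • q)) (Icc (-a) a) := by
  obtain ⟨L, hL⟩ := h.lip
  refine ⟨L.toNNReal, fun t ht => ?_⟩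
  refine Convex.lipschitzOnWith_of_nnnorm_hasDerivWithin_le
    (f' := fun z => fderiv ℝ f (A + t • p + z • q) q) (convex_Icc _ _) (fun z hz => ?_)
    (fun z hz => ?_)
  · have h1 : HasDerivAt (fun z : ℝ => A + t • p + z • q) q z := by
      simpa using ((hasDerivAt_id z).smul_const q).const_add (A + t • p)
    exact ((h.diff t z ht (abs_le.2 hz)).hasFDerivAt.comp_hasDerivAt z h1).hasDerivWithinAt
  · rw [← NNReal.coe_le_coe]
    exact (hL t z ht (abs_le.2 hz)).trans (Real.le_coe_toNNReal L)

/-- Existence of characteristics staying in the box. -/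
lemma exists_characteristic (h : CharBox f A p q T a M η g) (ha : 0 ≤ a) {z₀ : ℝ}
    (hz₀ : |z₀| ≤ a / 2) :
    ∃ ζ : ℝ → ℝ, ζ 0 = z₀ ∧ ∀ t ∈ Icc (-T) T,
      HasDerivWithinAt ζ (f (A + t • p + ζ t • q)) (Icc (-T) T) t ∧ ζ t ∈ Icc (-a) a := by
  obtain ⟨L, hL⟩ := h.exists_lipschitzOnWith
  have hT := h.T_pos
  have hM := h.M_nonneg ha
  have hball : Metric.closedBall z₀ (a / 2) ⊆ Icc (-a) a := by
    intro z hz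
    rw [Metric.mem_closedBall, Real.dist_eq] at hz
    rw [abs_le] at hz hz₀
    constructor <;> linarith [hz.1, hz.2, hz₀.1, hz₀.2]
  have hPL : IsPicardLindelof (fun t z : ℝ => f (A + t • p + z • q))
      (⟨0, by simpa using hT.le, hT.le⟩ : Icc (-T) T) z₀ ⟨a / 2, by positivity⟩ 0 ⟨M, hM⟩ L := by
    refine ⟨fun t ht => (hL t (abs_le.2 ht)).mono hball, fun z hz t ht => ?_,
      fun t ht z hz => h.bound t z (abs_le.2 ht) (abs_le.2 (hball hz)), ?_⟩
    · have h1 : ContinuousAt (fun t : ℝ => A + t • p + z • q) t := by fun_prop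
      exact (ContinuousAt.comp (f := fun t : ℝ => A + t • p + z • q)
        (h.diff t z (abs_le.2 ht) (abs_le.2 (hball hz))).continuousAt h1).continuousWithinAt
    · change M * max (T - 0) (0 - -T) ≤ a / 2 - 0
      simpa using h.small
  obtain ⟨ζ, h0, hζ⟩ := exists_hasDerivWithinAt_mem_closedBall hPL
  exact ⟨ζ, h0, fun t ht => ⟨(hζ t ht).1, hball (hζ t ht).2⟩⟩

/-- Along a characteristic, `f` has derivative close to `g`. -/
lemma hasDerivWithinAt_comp (h : CharBox f A p q T a M η g) {ζ : ℝ → ℝ} {t : ℝ}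
    (ht : t ∈ Icc (-T) T)
    (hζ : HasDerivWithinAt ζ (f (A + t • p + ζ t • q)) (Icc (-T) T) t) (hm : ζ t ∈ Icc (-a) a) :
    HasDerivWithinAt (fun t => f (A + t • p + ζ t • q))
      (fderiv ℝ f (A + t • p + ζ t • q) (p + f (A + t • p + ζ t • q) • q)) (Icc (-T) T) t := by
  have h1 : HasDerivWithinAt (fun t : ℝ => A + t • p + ζ t • q)
      (p + f (A + t • p + ζ t • q) • q) (Icc (-T) T) t := by
    have h2 : HasDerivAt (fun t : ℝ => A + t • p) p t := by
      simpa using ((hasDerivAt_id t).smul_const p).const_add A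
    exact h2.hasDerivWithinAt.add (hζ.smul_const q)
  exact (h.diff t (ζ t) (abs_le.2 ht) (abs_le.2 hm)).hasFDerivAt.comp_hasDerivWithinAt t h1

/-- Two distinct characteristics do not cross. -/
lemma characteristics_lt (h : CharBox f A p q T a M η g) {ζ₀ ζ₁ : ℝ → ℝ}
    (h₀ : ∀ t ∈ Icc (-T) T,
      HasDerivWithinAt ζ₀ (f (A + t • p + ζ₀ t • q)) (Icc (-T) T) t ∧ ζ₀ t ∈ Icc (-a) a)
    (h₁ : ∀ t ∈ Icc (-T) T,
      HasDerivWithinAt ζ₁ (f (A + t • p + ζ₁ t • q)) (Icc (-T) T) t ∧ ζ₁ t ∈ Icc (-a) a)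
    (hlt : ζ₀ 0 < ζ₁ 0) {t : ℝ} (ht : t ∈ Ioo (-T) T) : ζ₀ t < ζ₁ t := by
  obtain ⟨L, hL⟩ := h.exists_lipschitzOnWith
  have hT := h.T_pos
  have h0 : (0 : ℝ) ∈ Ioo (-T) T := ⟨by linarith, hT⟩
  have hne : ∀ s ∈ Ioo (-T) T, ζ₀ s ≠ ζ₁ s := by
    intro s hs heq
    have := ODE_solution_unique_of_mem_Ioo (v := fun t z : ℝ => f (A + t • p + z • q))
      (s := fun _ => Icc (-a) a) (K := L) (f := ζ₀) (g := ζ₁)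
      (fun t ht => hL t (abs_le.2 (Ioo_subset_Icc_self ht))) hs
      (fun t ht => ⟨(h₀ t (Ioo_subset_Icc_self ht)).1.hasDerivAt (Icc_mem_nhds ht.1 ht.2),
        (h₀ t (Ioo_subset_Icc_self ht)).2⟩)
      (fun t ht => ⟨(h₁ t (Ioo_subset_Icc_self ht)).1.hasDerivAt (Icc_mem_nhds ht.1 ht.2),
        (h₁ t (Ioo_subset_Icc_self ht)).2⟩) heq h0
    exact hlt.ne this
  by_contra! hcon
  have hc : ContinuousOn (fun t => ζ₁ t - ζ₀ t) (Ioo (-T) T) := fun s hs =>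
    (((h₁ s (Ioo_subset_Icc_self hs)).1.continuousWithinAt.sub
      (h₀ s (Ioo_subset_Icc_self hs)).1.continuousWithinAt).mono Ioo_subset_Icc_self)
  obtain ⟨s, hs, hs0⟩ := isPreconnected_Ioo.intermediate_value ht h0 hc
    (show (0 : ℝ) ∈ Icc (ζ₁ t - ζ₀ t) (ζ₁ 0 - ζ₀ 0) from ⟨by linarith, by linarith⟩)
  exact hne s hs (by simp only at hs0; linarith)

/-- Along a characteristic, `f` is affine with slope `g` up to the error `η`. -/
lemma abs_comp_sub_le (h : CharBox f A p q T a M η g) {ζ : ℝ → ℝ}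
    (hζ : ∀ t ∈ Icc (-T) T,
      HasDerivWithinAt ζ (f (A + t • p + ζ t • q)) (Icc (-T) T) t ∧ ζ t ∈ Icc (-a) a)
    {t : ℝ} (ht : |t| ≤ T) :
    |f (A + t • p + ζ t • q) - f (A + ζ 0 • q) - t * g| ≤ η * |t| := by
  have hT := h.T_pos
  have := Convex.norm_image_sub_le_of_norm_hasDerivWithin_le
    (f := fun t => f (A + t • p + ζ t • q) - t * g)
    (f' := fun t => fderiv ℝ f (A + t • p + ζ t • q) (p + f (A + t • p + ζ t • q) • q) - 1 * g)
    (s := Icc (-T) T) (C := η) (x := 0) (y := t)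
    (fun s hs => (h.hasDerivWithinAt_comp hs (hζ s hs).1 (hζ s hs).2).sub
      ((hasDerivAt_id s).mul_const g).hasDerivWithinAt)
    (fun s hs => by
      rw [one_mul]; exact h.along s (ζ s) (abs_le.2 hs) (abs_le.2 (hζ s hs).2))
    (convex_Icc _ _) ⟨by linarith, hT.le⟩ (abs_le.1 ht)
  simp only [Real.norm_eq_abs, sub_zero, zero_mul, zero_smul, add_zero] at this
  rwa [sub_right_comm] at this

lemma exists_abs_sub_le (h : CharBox f A p q T a M η g) (ha : 0 ≤ a) {t : ℝ} (ht : |t| ≤ T) :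
    ∃ z : ℝ, |z - t * f A| ≤ (|g| + η) * t ^ 2 ∧
      |f (A + t • p + z • q) - f A - t * g| ≤ η * |t| := by
  obtain ⟨ζ, hζ0, hζ⟩ := h.exists_characteristic ha (z₀ := 0) (by simpa using by positivity)
  have hη := h.eta_nonneg ha
  have key : ∀ s, |s| ≤ T → |f (A + s • p + ζ s • q) - f A - s * g| ≤ η * |s| := by
    intro s hs
    simpa [hζ0] using h.abs_comp_sub_le hζ hs
  refine ⟨ζ t, ?_, key t ht⟩
  have hsub : Icc (-|t|) |t| ⊆ Icc (-T) T := Icc_subset_Icc (by linarith) ht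
  have := Convex.norm_image_sub_le_of_norm_hasDerivWithin_le
    (f := fun s => ζ s - s * f A)
    (f' := fun s => f (A + s • p + ζ s • q) - 1 * f A)
    (s := Icc (-|t|) |t|) (C := (|g| + η) * |t|) (x := 0) (y := t)
    (fun s hs => ((hζ s (hsub hs)).1.mono hsub).sub
      ((hasDerivAt_id s).mul_const (f A)).hasDerivWithinAt)
    (fun s hs => by
      have h1 := key s (abs_le.2 (hsub hs))
      have h2 : |s| ≤ |t| := abs_le.2 hs
      rw [one_mul, Real.norm_eq_abs]
      calc |f (A + s • p + ζ s • q) - f A|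
          = |(f (A + s • p + ζ s • q) - f A - s * g) + s * g| := by ring_nf
        _ ≤ η * |s| + |s| * |g| := (abs_add_le _ _).trans (by rw [abs_mul s g]; gcongr)
        _ = (|g| + η) * |s| := by ring
        _ ≤ _ := by gcongr)
    (convex_Icc _ _) (by simp) (abs_le.1 le_rfl)
  simpa [hζ0, mul_assoc, ← sq] using this

lemma abs_sub_le_of_lt (h : CharBox f A p q T a M η g) {z₀ z₁ : ℝ}
    (hz₀ : |z₀| ≤ a / 2) (hz₁ : |z₁| ≤ a / 2) (hlt : z₀ < z₁) (hη : 0 < η)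
    (hs : z₁ - z₀ < η * T ^ 2) :
    |f (A + z₁ • q) - f (A + z₀ • q)| ≤ 3 * √η * √(z₁ - z₀) := by
  have ha : 0 ≤ a := by linarith [abs_nonneg z₀]
  have hT := h.T_pos
  obtain ⟨ζ₀, h00, h₀⟩ := h.exists_characteristic ha hz₀
  obtain ⟨ζ₁, h10, h₁⟩ := h.exists_characteristic ha hz₁
  set c := f (A + z₁ • q) - f (A + z₀ • q) with hc
  set d := z₁ - z₀ with hd
  have hdpos : 0 < d := by linarith
  have key : ∀ t, |t| < T → 0 < d + c * t + 2 * η * t ^ 2 := by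
    intro t ht
    have hsub : Icc (-|t|) |t| ⊆ Icc (-T) T := Icc_subset_Icc (by linarith) ht.le
    have := Convex.norm_image_sub_le_of_norm_hasDerivWithin_le
      (f := fun s => (ζ₁ s - ζ₀ s) - s * c)
      (f' := fun s => (f (A + s • p + ζ₁ s • q) - f (A + s • p + ζ₀ s • q)) - 1 * c)
      (s := Icc (-|t|) |t|) (C := 2 * η * |t|) (x := 0) (y := t)
      (fun s hs => (((h₁ s (hsub hs)).1.mono hsub).sub ((h₀ s (hsub hs)).1.mono hsub)).sub
        ((hasDerivAt_id s).mul_const c).hasDerivWithinAt)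
      (fun s hs => by
        have h1 := h.abs_comp_sub_le h₁ (abs_le.2 (hsub hs))
        have h2 := h.abs_comp_sub_le h₀ (abs_le.2 (hsub hs))
        have h3 : η * |s| ≤ η * |t| :=
          mul_le_mul_of_nonneg_left (abs_le.2 hs) hη.le
        rw [h10] at h1
        rw [h00] at h2
        rw [Real.norm_eq_abs]
        rw [abs_le] at h1 h2 ⊢
        constructor <;> linarith [h1.1, h1.2, h2.1, h2.2])
      (convex_Icc _ _) (by simp) (abs_le.1 le_rfl)
    have hpos := h.characteristics_lt h₀ h₁ (by rw [h00, h10]; exact hlt) (abs_lt.1 ht)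
    simp only [h00, h10, Real.norm_eq_abs, zero_mul, sub_zero] at this
    have h4 := (abs_le.1 this).2
    have h5 : 2 * η * |t| * |t| = 2 * η * t ^ 2 := by rw [mul_assoc, ← sq, sq_abs]
    rw [h5] at h4
    linarith
  set x := √η with hx
  set y := √d with hy
  have hx2 : η = x ^ 2 := (Real.sq_sqrt hη.le).symm
  have hy2 : d = y ^ 2 := (Real.sq_sqrt hdpos.le).symm
  have hxp : 0 < x := Real.sqrt_pos.2 hη
  have hyp : 0 < y := Real.sqrt_pos.2 hdpos
  have hr : y / x < T := by
    rw [div_lt_iff₀ hxp]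
    refine lt_of_pow_lt_pow_left₀ 2 (by positivity) ?_
    rw [← hy2, mul_pow, ← hx2]
    linarith
  have e1 := key (y / x) (by rwa [abs_of_pos (by positivity)])
  have e2 := key (-(y / x)) (by rwa [abs_neg, abs_of_pos (by positivity)])
  have hq : 2 * η * (y / x) ^ 2 = 2 * y ^ 2 := by rw [hx2]; field_simp
  have hcq : c * (y / x) = c / x * y := by ring
  rw [neg_sq, hq, hy2] at e2
  rw [hq, hy2] at e1
  have e3 : -(3 * y) ≤ c / x := by
    have : 0 < (3 * y + c / x) * y := by linarith
    linarith [pos_of_mul_pos_left this hyp.le]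
  have e4 : c / x ≤ 3 * y := by
    have : 0 < (3 * y - c / x) * y := by linarith
    linarith [pos_of_mul_pos_left this hyp.le]
  rw [le_div_iff₀ hxp] at e3
  rw [div_le_iff₀ hxp] at e4
  exact abs_le.2 ⟨by linarith, by linarith⟩

/-- Square-root continuity in the direction `q`, with small constant. -/
lemma abs_add_smul_sub_le (h : CharBox f A p q T a M η g) {z : ℝ} (hη : 0 < η)
    (hz : |z| ≤ a / 2) (hs : |z| < η * T ^ 2) :
    |f (A + z • q) - f A| ≤ 3 * √η * √|z| := by
  have ha : |(0 : ℝ)| ≤ a / 2 := by simpa using (abs_nonneg z).trans hz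
  rcases lt_trichotomy z 0 with hz0 | rfl | hz0
  · have := h.abs_sub_le_of_lt hz ha hz0 hη (by rwa [zero_sub, ← abs_of_neg hz0])
    rwa [zero_sub, ← abs_of_neg hz0, zero_smul, add_zero, abs_sub_comm] at this
  · simp
  · have := h.abs_sub_le_of_lt ha hz hz0 hη (by rwa [sub_zero, ← abs_of_pos hz0])
    rwa [sub_zero, zero_smul, add_zero, ← congrArg Real.sqrt (abs_of_pos hz0)] at this

end CharBox

end Characteristics

section LittleHolder

lemma exists_compact_add_mem {E : Type*} [NormedAddCommGroup E] [ProperSpace E] {O K : Set E}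
    (hO : IsOpen O) (hK : K ⊆ O) (hc : IsCompact K) :
    ∃ K' ⊆ O, IsCompact K' ∧ K ⊆ K' ∧ ∃ δ > 0, ∀ A ∈ K, ∀ x, ‖x‖ ≤ δ → A + x ∈ K' := by
  obtain ⟨δ, hδ, h⟩ := hc.exists_cthickening_subset_open hO hK
  exact ⟨_, h, hc.cthickening, Metric.self_subset_cthickening K, δ, hδ, fun A hA x hx =>
    Metric.mem_cthickening_of_dist_le _ A _ _ hA (by simpa using hx)⟩

variable {E : Type*} [NormedAddCommGroup E] [NormedSpace ℝ E]

/-- The oscillation of `ψ` in the direction `v` is `o(√|z|)`, locally uniformly in `O`. -/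
def LittleHolder (O : Set E) (ψ : E → ℝ) (v : E) : Prop :=
  ∀ K ⊆ O, IsCompact K → ∀ η > 0, ∃ τ > 0, ∀ A ∈ K, ∀ z : ℝ, |z| ≤ τ →
    |ψ (A + z • v) - ψ A| ≤ η * √|z|

namespace LittleHolder

variable {O : Set E} {ψ : E → ℝ}

lemma sum [ProperSpace E] (hO : IsOpen O) {ι : Type*} (s : Finset ι) (v : ι → E)
    (hv : ∀ i ∈ s, LittleHolder O ψ (v i)) :
    ∀ K ⊆ O, IsCompact K → ∀ η > 0, ∃ τ > 0, ∀ A ∈ K, ∀ c : ι → ℝ, ∀ r ≤ τ,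
      (∀ i ∈ s, |c i| ≤ r) → |ψ (A + ∑ i ∈ s, c i • v i) - ψ A| ≤ η * √r := by
  classical
  induction s using Finset.induction_on with
  | empty =>
    intro K _ _ η hη
    exact ⟨1, one_pos, fun A _ c r _ _ => by simpa using by positivity⟩
  | insert i s hi ih =>
    intro K hK hc η hη
    obtain ⟨K', hK', hc', -, δ, hδ, hadd⟩ := exists_compact_add_mem hO hK hc
    obtain ⟨τ₁, hτ₁, h₁⟩ := ih (fun j hj => hv j (Finset.mem_insert_of_mem hj)) K' hK' hc'
      (η / 2) (by positivity)
    obtain ⟨τ₂, hτ₂, h₂⟩ := hv i (Finset.mem_insert_self _ _) K hK hc (η / 2) (by positivity)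
    refine ⟨min (min τ₁ τ₂) (δ / (‖v i‖ + 1)), by positivity, fun A hA c r hr hcr => ?_⟩
    have hr₁ : r ≤ τ₁ := hr.trans ((min_le_left _ _).trans (min_le_left _ _))
    have hr₂ : r ≤ τ₂ := hr.trans ((min_le_left _ _).trans (min_le_right _ _))
    have hr₃ : r ≤ δ / (‖v i‖ + 1) := hr.trans (min_le_right _ _)
    have hci := hcr i (Finset.mem_insert_self _ _)
    have hmem : A + c i • v i ∈ K' := by
      refine hadd A hA _ ?_
      rw [norm_smul, Real.norm_eq_abs]
      rw [le_div_iff₀ (by positivity)] at hr₃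
      have : |c i| * (‖v i‖ + 1) ≤ r * (‖v i‖ + 1) := by gcongr
      linarith [abs_nonneg (c i)]
    have e₁ := h₁ _ hmem c r hr₁ (fun j hj => hcr j (Finset.mem_insert_of_mem hj))
    have e₂ := h₂ A hA (c i) (hci.trans hr₂)
    have e₃ : η / 2 * √|c i| ≤ η / 2 * √r := by gcongr
    rw [Finset.sum_insert hi, ← add_assoc]
    rw [abs_le] at e₁ e₂ ⊢
    constructor <;> linarith [e₁.1, e₁.2, e₂.1, e₂.2]

lemma sum_of_le_mul [ProperSpace E] (hO : IsOpen O) {ι : Type*} [Fintype ι] (v : ι → E)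
    (hv : ∀ i, LittleHolder O ψ (v i)) {K : Set E} (hK : K ⊆ O) (hc : IsCompact K)
    {C η : ℝ} (hC : 0 < C) (hη : 0 < η) :
    ∃ τ > 0, ∀ A ∈ K, ∀ c : ι → ℝ, ∀ r, 0 ≤ r → r ≤ τ →
      (∀ i, |c i| ≤ C * r) → |ψ (A + ∑ i, c i • v i) - ψ A| ≤ η * √r := by
  obtain ⟨τ, hτ, h⟩ := sum hO Finset.univ v (fun i _ => hv i) K hK hc (η / √C) (by positivity)
  refine ⟨τ / C, by positivity, fun A hA c r hr hrτ hcr => ?_⟩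
  have := h A hA c (C * r) (by rwa [le_div_iff₀' hC] at hrτ) (fun i _ => hcr i)
  rwa [Real.sqrt_mul hC.le, ← mul_assoc, div_mul_cancel₀ _ (by positivity)] at this

lemma of_mem_span [ProperSpace E] (hO : IsOpen O) {ι : Type*} [Fintype ι] (v : ι → E)
    (hv : ∀ i, LittleHolder O ψ (v i)) {x : E} (hx : x ∈ Submodule.span ℝ (range v)) :
    LittleHolder O ψ x := by
  obtain ⟨c, rfl⟩ := (Submodule.mem_span_range_iff_exists_fun ℝ).1 hx
  intro K hK hc η hη
  obtain ⟨τ, hτ, h⟩ := sum_of_le_mul hO v hv hK hc (C := ∑ i, |c i| + 1) (by positivity) hη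
  refine ⟨τ, hτ, fun A hA z hz => ?_⟩
  have := h A hA (fun i => z * c i) |z| (abs_nonneg z) hz (fun i => by
    have := Finset.single_le_sum (f := fun i => |c i|) (fun j _ => abs_nonneg _)
      (Finset.mem_univ i)
    rw [abs_mul, mul_comm]
    gcongr
    linarith)
  simpa only [Finset.smul_sum, smul_smul] using this

lemma of_nonneg {v : E}
    (hp : ∀ K ⊆ O, IsCompact K → ∀ η > 0, ∃ τ > 0, ∀ A ∈ K, ∀ z : ℝ, 0 ≤ z → z ≤ τ →
      |ψ (A + z • v) - ψ A| ≤ η * √z)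
    (hn : ∀ K ⊆ O, IsCompact K → ∀ η > 0, ∃ τ > 0, ∀ A ∈ K, ∀ z : ℝ, 0 ≤ z → z ≤ τ →
      |ψ (A + z • (-v)) - ψ A| ≤ η * √z) : LittleHolder O ψ v := by
  intro K hK hc η hη
  obtain ⟨τ₁, hτ₁, h₁⟩ := hp K hK hc η hη
  obtain ⟨τ₂, hτ₂, h₂⟩ := hn K hK hc η hη
  refine ⟨min τ₁ τ₂, by positivity, fun A hA z hz => ?_⟩
  rcases le_total 0 z with h0 | h0
  · rw [abs_of_nonneg h0] at hz ⊢
    exact h₁ A hA z h0 (hz.trans (min_le_left _ _))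
  · rw [abs_of_nonpos h0] at hz ⊢
    simpa using h₂ A hA (-z) (by linarith) (hz.trans (min_le_right _ _))

end LittleHolder

end LittleHolder

section ApproxSolution

variable {E : Type*} [NormedAddCommGroup E] [NormedSpace ℝ E]

/-- `ψ` is a locally uniform limit of `C¹` functions `F i` along whose characteristic directions
`p + F i • q` the derivatives converge to `g`. The field `p` is constant along the affine planes
spanned by its value and `q`. -/
structure IsApproxSolution {ι : Type*} (l : Filter ι) (F : ι → E → ℝ) (O : Set E) (ψ g : E → ℝ)
    (p : E → E) (q : E) : Prop where
  continuous_p : Continuous p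
  p_add : ∀ A, ∀ t z : ℝ, p (A + t • p A + z • q) = p A
  continuousOn_ψ : ContinuousOn ψ O
  continuousOn_g : ContinuousOn g O
  contDiffOn : ∀ᶠ i in l, ContDiffOn ℝ 1 (F i) O
  lim : ∀ K ⊆ O, IsCompact K → TendstoUniformlyOn F ψ l K
  lim_deriv : ∀ K ⊆ O, IsCompact K →
    TendstoUniformlyOn (fun i P => fderiv ℝ (F i) P (p P + F i P • q)) g l K

namespace IsApproxSolution

variable {ι : Type*} {l : Filter ι} {F : ι → E → ℝ} {O : Set E} {ψ g : E → ℝ} {p : E → E} {q : E}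

lemma exists_charBox [ProperSpace E] (h : IsApproxSolution l F O ψ g p q) (hO : IsOpen O)
    {K : Set E} (hK : K ⊆ O) (hc : IsCompact K) {η : ℝ} (hη : 0 < η) :
    ∃ T > 0, ∃ a > 0, ∃ M, ∀ᶠ i in l, ∀ A ∈ K, CharBox (F i) A (p A) q T a M η (g A) := by
  obtain ⟨K', hK', hc', hKK', δ, hδ, hadd⟩ := exists_compact_add_mem hO hK hc
  obtain ⟨M, hM⟩ := hc'.exists_bound_of_continuousOn (h.continuousOn_ψ.mono hK')
  obtain ⟨C, hC⟩ := hc.exists_bound_of_continuousOn h.continuous_p.continuousOn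
  obtain ⟨ρ, hρ, hg⟩ := Metric.uniformContinuousOn_iff.1
    (hc'.uniformContinuousOn_of_continuous (h.continuousOn_g.mono hK')) (η / 2) (by positivity)
  set σ := min δ (ρ / 2) with hσ
  have hσpos : 0 < σ := by positivity
  set a := σ / (2 * (‖q‖ + 1)) with ha
  have hapos : 0 < a := by positivity
  set T := min (σ / (2 * (|C| + 1))) (a / (2 * (|M| + 1))) with hT
  have hTpos : 0 < T := by positivity
  have hT₁ : T * (2 * (|C| + 1)) ≤ σ := (le_div_iff₀ (by positivity)).1 (min_le_left _ _)
  have hT₂ : T * (2 * (|M| + 1)) ≤ a := (le_div_iff₀ (by positivity)).1 (min_le_right _ _)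
  have ha₁ : a * (2 * (‖q‖ + 1)) = σ := div_mul_cancel₀ _ (by positivity)
  have hnorm : ∀ A ∈ K, ∀ t z : ℝ, |t| ≤ T → |z| ≤ a → ‖t • p A + z • q‖ ≤ σ := by
    intro A hA t z ht hz
    have e₁ : ‖t • p A‖ ≤ T * (|C| + 1) := by
      rw [norm_smul, Real.norm_eq_abs]
      gcongr
      linarith [hC A hA, le_abs_self C]
    have e₂ : ‖z • q‖ ≤ a * (‖q‖ + 1) := by
      rw [norm_smul, Real.norm_eq_abs]
      gcongr
      linarith
    linarith [norm_add_le (t • p A) (z • q)]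
  have hmem : ∀ A ∈ K, ∀ t z : ℝ, |t| ≤ T → |z| ≤ a → A + t • p A + z • q ∈ K' := by
    intro A hA t z ht hz
    rw [add_assoc]
    exact hadd A hA _ ((hnorm A hA t z ht hz).trans (min_le_left _ _))
  refine ⟨T, hTpos, a, hapos, |M| + 1, ?_⟩
  filter_upwards [h.contDiffOn, Metric.tendstoUniformlyOn_iff.1 (h.lim K' hK' hc') 1 one_pos,
    Metric.tendstoUniformlyOn_iff.1 (h.lim_deriv K' hK' hc') (η / 2) (by positivity)]
    with i h₁ h₂ h₃ A hA
  refine ⟨hTpos, by linarith, fun t z ht hz => ?_, fun t z ht hz => ?_, ?_, fun t z ht hz => ?_⟩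
  · exact (h₁.differentiableOn one_ne_zero).differentiableAt
      (hO.mem_nhds (hK' (hmem A hA t z ht hz)))
  · have e₁ := h₂ _ (hmem A hA t z ht hz)
    have e₂ := hM _ (hmem A hA t z ht hz)
    rw [Real.dist_eq, abs_sub_comm] at e₁
    rw [Real.norm_eq_abs] at e₂
    have := abs_sub_abs_le_abs_sub (F i (A + t • p A + z • q)) (ψ (A + t • p A + z • q))
    linarith [le_abs_self M]
  · have hcont : ContinuousOn (fun P => fderiv ℝ (F i) P q) K' :=
      ((h₁.continuousOn_fderiv_of_isOpen hO le_rfl).mono hK').clm_apply continuousOn_const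
    obtain ⟨L, hL⟩ := hc'.exists_bound_of_continuousOn hcont
    exact ⟨L, fun t z ht hz => hL _ (hmem A hA t z ht hz)⟩
  · have e₁ := h₃ _ (hmem A hA t z ht hz)
    have e₂ := hg _ (hmem A hA t z ht hz) A (hKK' hA) (by
      rw [add_assoc, dist_self_add_left]
      have := (hnorm A hA t z ht hz).trans (min_le_right _ _)
      linarith)
    rw [h.p_add, Real.dist_eq, abs_lt] at e₁
    rw [Real.dist_eq, abs_lt] at e₂
    rw [abs_le]
    constructor <;> linarith [e₁.1, e₁.2, e₂.1, e₂.2]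

lemma littleHolder [ProperSpace E] [l.NeBot] (h : IsApproxSolution l F O ψ g p q)
    (hO : IsOpen O) : LittleHolder O ψ q := by
  intro K hK hc η hη
  obtain ⟨K', hK', hc', hKK', δ, hδ, hadd⟩ := exists_compact_add_mem hO hK hc
  have hη' : 0 < (η / 3) ^ 2 := by positivity
  obtain ⟨T, hT, a, ha, M, hbox⟩ := h.exists_charBox hO hK hc hη'
  refine ⟨min (min (a / 2) ((η / 3) ^ 2 * T ^ 2 / 2)) (δ / (‖q‖ + 1)), by positivity,
    fun A hA z hz => ?_⟩
  have hz₁ : |z| ≤ a / 2 := hz.trans ((min_le_left _ _).trans (min_le_left _ _))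
  have hz₂ : |z| ≤ (η / 3) ^ 2 * T ^ 2 / 2 :=
    hz.trans ((min_le_left _ _).trans (min_le_right _ _))
  have hz₃ : |z| * (‖q‖ + 1) ≤ δ :=
    (le_div_iff₀ (by positivity)).1 (hz.trans (min_le_right _ _))
  have hmem : A + z • q ∈ K' := by
    refine hadd A hA _ ?_
    rw [norm_smul, Real.norm_eq_abs]
    linarith [abs_nonneg z]
  have hpos : 0 < (η / 3) ^ 2 * T ^ 2 := by positivity
  have hlim : Tendsto (fun i => |F i (A + z • q) - F i A|) l (𝓝 |ψ (A + z • q) - ψ A|) :=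
    (((h.lim K' hK' hc').tendsto_at hmem).sub ((h.lim K hK hc).tendsto_at hA)).abs
  refine le_of_tendsto hlim ?_
  filter_upwards [hbox] with i hi
  have := (hi A hA).abs_add_smul_sub_le hη' hz₁ (by linarith)
  rwa [Real.sqrt_sq (by positivity), mul_div_cancel₀ _ (by norm_num)] at this

/-- First-order expansion of `ψ` along the field `p + ψ q`. -/
lemma expansion [ProperSpace E] [l.NeBot] (h : IsApproxSolution l F O ψ g p q)
    (hO : IsOpen O) {K : Set E} (hK : K ⊆ O) (hc : IsCompact K) {η : ℝ} (hη : 0 < η) :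
    ∃ τ > 0, ∀ A ∈ K, ∀ t : ℝ, |t| ≤ τ →
      |ψ (A + t • (p A + ψ A • q)) - ψ A - t * g A| ≤ η * |t| := by
  obtain ⟨K', hK', hc', hKK', δ, hδ, hadd⟩ := exists_compact_add_mem hO hK hc
  obtain ⟨M, hM⟩ := hc.exists_bound_of_continuousOn (h.continuousOn_ψ.mono hK)
  obtain ⟨G, hG⟩ := hc.exists_bound_of_continuousOn (h.continuousOn_g.mono hK)
  obtain ⟨C, hC⟩ := hc.exists_bound_of_continuousOn h.continuous_p.continuousOn
  obtain ⟨T, hT, a, ha, _, hbox⟩ := h.exists_charBox hO hK hc (show 0 < η / 4 by positivity)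
  set N := |G| + η / 4 + 1 with hN
  have hNpos : 0 < N := by positivity
  obtain ⟨τ', hτ', hhol⟩ := h.littleHolder hO K' hK' hc' (η / (4 * √N)) (by positivity)
  set R := |C| + (|M| + N) * ‖q‖ + 1 with hR
  have hRpos : 0 < R := by positivity
  refine ⟨min (min T 1) (min (δ / R) (τ' / N)), by positivity, fun A hA t ht => ?_⟩
  have ht₁ : |t| ≤ T := ht.trans ((min_le_left _ _).trans (min_le_left _ _))
  have ht₂ : |t| ≤ 1 := ht.trans ((min_le_left _ _).trans (min_le_right _ _))
  have ht₃ : |t| * R ≤ δ :=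
    (le_div_iff₀ hRpos).1 (ht.trans ((min_le_right _ _).trans (min_le_left _ _)))
  have ht₄ : |t| * N ≤ τ' :=
    (le_div_iff₀ hNpos).1 (ht.trans ((min_le_right _ _).trans (min_le_right _ _)))
  rcases eq_or_ne t 0 with rfl | ht0
  · simp
  have htpos : 0 < |t| := abs_pos.2 ht0
  have htsq : t ^ 2 ≤ |t| := by
    rw [← sq_abs, sq]
    exact mul_le_of_le_one_left htpos.le ht₂
  obtain ⟨i, hi, hclose⟩ := (hbox.and (Metric.tendstoUniformlyOn_iff.1 (h.lim K' hK' hc')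
    (|t| * min 1 (η / 4)) (by positivity))).exists
  have hcl₁ : ∀ P ∈ K', |ψ P - F i P| ≤ |t| := fun P hP =>
    (hclose P hP).le.trans (mul_le_of_le_one_right htpos.le (min_le_left _ _))
  have hcl₂ : ∀ P ∈ K', |ψ P - F i P| ≤ |t| * (η / 4) := fun P hP =>
    (hclose P hP).le.trans (by gcongr; exact min_le_right _ _)
  obtain ⟨z, hz, hexp⟩ := (hi A hA).exists_abs_sub_le ha.le ht₁
  have hMA : |ψ A| ≤ |M| := (hM A hA).trans (le_abs_self M)
  have hGA : |g A| ≤ |G| := (hG A hA).trans (le_abs_self G)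
  have hCA : ‖p A‖ ≤ |C| := (hC A hA).trans (le_abs_self C)
  have hzψ : |z - t * ψ A| ≤ N * t ^ 2 := by
    have e₁ : |t * F i A - t * ψ A| ≤ 1 * t ^ 2 := by
      rw [← mul_sub, abs_mul, abs_sub_comm, one_mul, ← sq_abs, sq]
      have := hcl₁ A (hKK' hA)
      gcongr
    have e₂ : (|g A| + η / 4) * t ^ 2 ≤ (|G| + η / 4) * t ^ 2 := by gcongr
    calc |z - t * ψ A| ≤ |z - t * F i A| + |t * F i A - t * ψ A| := abs_sub_le _ _ _
      _ ≤ (|G| + η / 4) * t ^ 2 + 1 * t ^ 2 := add_le_add (hz.trans e₂) e₁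
      _ = N * t ^ 2 := by rw [hN]; ring
  have htψ : |t * ψ A| ≤ |t| * |M| := by
    rw [abs_mul]; gcongr
  have hzabs : |z| ≤ |t| * (|M| + N) := by
    have e₁ : |z| ≤ |z - t * ψ A| + |t * ψ A| := by
      simpa using abs_add_le (z - t * ψ A) (t * ψ A)
    have e₂ : N * t ^ 2 ≤ N * |t| := by gcongr
    linarith
  have hmemz : ∀ y : ℝ, |y| ≤ |t| * (|M| + N) → A + t • p A + y • q ∈ K' := by
    intro y hy
    rw [add_assoc]
    refine hadd A hA _ ((norm_add_le _ _).trans ?_)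
    rw [norm_smul, norm_smul, Real.norm_eq_abs, Real.norm_eq_abs]
    have e₁ : |t| * ‖p A‖ ≤ |t| * |C| := by gcongr
    have e₂ : |y| * ‖q‖ ≤ |t| * (|M| + N) * ‖q‖ := by gcongr
    have e₃ : |t| * R = |t| * |C| + |t| * (|M| + N) * ‖q‖ + |t| := by rw [hR]; ring
    linarith
  set B := A + t • p A + (t * ψ A) • q with hB
  have hBmem : B ∈ K' := hmemz _ (htψ.trans (by gcongr; linarith))
  have hBeq : A + t • (p A + ψ A • q) = B := by rw [hB, smul_add, smul_smul, add_assoc]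
  have hPeq : A + t • p A + z • q = B + (z - t * ψ A) • q := by
    rw [hB, sub_smul]; abel
  have e₁ := hcl₂ _ (hmemz z hzabs)
  have e₂ := hcl₂ A (hKK' hA)
  have e₃ : |ψ (A + t • p A + z • q) - ψ B| ≤ η / 4 * |t| := by
    have e₄ : N * t ^ 2 ≤ N * |t| := by gcongr
    have := hhol B hBmem (z - t * ψ A) (by linarith)
    rw [hPeq]
    refine this.trans ?_
    have e₅ : √|z - t * ψ A| ≤ √N * |t| := by
      rw [← Real.sqrt_sq_eq_abs t, ← Real.sqrt_mul hNpos.le]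
      exact Real.sqrt_le_sqrt hzψ
    calc η / (4 * √N) * √|z - t * ψ A| ≤ η / (4 * √N) * (√N * |t|) := by gcongr
      _ = η / 4 * |t| := by
        have : √N ≠ 0 := (Real.sqrt_pos.2 hNpos).ne'
        field_simp
  rw [hBeq]
  rw [abs_le] at e₁ e₂ e₃ hexp ⊢
  constructor <;> linarith [e₁.1, e₁.2, e₂.1, e₂.2, e₃.1, e₃.2, hexp.1, hexp.2]

/-- The commutator of two fields `p₁ + ψ q₁` and `p₂ + ψ q₂` is a direction of small
`1/2`-Hölder oscillation. -/
lemma commutator [ProperSpace E] [l.NeBot] {g₁ g₂ : E → ℝ} {p₁ p₂ : E → E} {q₁ q₂ c : E}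
    (h₁ : IsApproxSolution l F O ψ g₁ p₁ q₁) (h₂ : IsApproxSolution l F O ψ g₂ p₂ q₂)
    (hO : IsOpen O)
    (hloop : ∀ (P₀ P₁ P₂ P₃ P₄ : E) (t a₀ a₁ a₂ a₃ : ℝ),
      P₁ = P₀ + t • (p₁ P₀ + a₀ • q₁) → P₂ = P₁ + t • (p₂ P₁ + a₁ • q₂) →
      P₃ = P₂ + (-t) • (p₁ P₂ + a₂ • q₁) → P₄ = P₃ + (-t) • (p₂ P₃ + a₃ • q₂) →
      P₄ = P₀ + t ^ 2 • c + ((t * (a₀ - a₂)) • q₁ + (t * (a₁ - a₃)) • q₂)) :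
    ∀ K ⊆ O, IsCompact K → ∀ η > 0, ∃ τ > 0, ∀ A ∈ K, ∀ z : ℝ, 0 ≤ z → z ≤ τ →
      |ψ (A + z • c) - ψ A| ≤ η * √z := by
  intro K hK hc η hη
  obtain ⟨K', hK', hc', hKK', δ, hδ, hadd⟩ := exists_compact_add_mem hO hK hc
  obtain ⟨M, hM⟩ := hc'.exists_bound_of_continuousOn (h₁.continuousOn_ψ.mono hK')
  obtain ⟨G₁, hG₁⟩ := hc'.exists_bound_of_continuousOn (h₁.continuousOn_g.mono hK')
  obtain ⟨G₂, hG₂⟩ := hc'.exists_bound_of_continuousOn (h₂.continuousOn_g.mono hK')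
  obtain ⟨C₁, hC₁⟩ := hc'.exists_bound_of_continuousOn h₁.continuous_p.continuousOn
  obtain ⟨C₂, hC₂⟩ := hc'.exists_bound_of_continuousOn h₂.continuous_p.continuousOn
  obtain ⟨ρ₁, hρ₁, hu₁⟩ := Metric.uniformContinuousOn_iff.1
    (hc'.uniformContinuousOn_of_continuous (h₁.continuousOn_g.mono hK')) (η / 8) (by positivity)
  obtain ⟨ρ₂, hρ₂, hu₂⟩ := Metric.uniformContinuousOn_iff.1
    (hc'.uniformContinuousOn_of_continuous (h₂.continuousOn_g.mono hK')) (η / 8) (by positivity)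
  obtain ⟨τ₁, hτ₁, hx₁⟩ := h₁.expansion hO hK' hc' (η := η / 8) (by positivity)
  obtain ⟨τ₂, hτ₂, hx₂⟩ := h₂.expansion hO hK' hc' (η := η / 8) (by positivity)
  set D := |G₁| + |G₂| + η / 4 with hD
  have hDpos : 0 < D := by positivity
  obtain ⟨τ₃, hτ₃, hx₃⟩ := LittleHolder.sum_of_le_mul hO ![q₁, q₂]
    (by
      intro i
      fin_cases i
      · exact h₁.littleHolder hO
      · exact h₂.littleHolder hO) hK' hc' hDpos (show 0 < η / 8 by positivity)
  set R := |C₁| + |C₂| + |M| * (‖q₁‖ + ‖q₂‖) + 1 with hR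
  have hRpos : 0 < R := by positivity
  set σ := min δ (min ρ₁ ρ₂) / (4 * R) with hσ
  have hσpos : 0 < σ := by positivity
  refine ⟨min (min ((min τ₁ τ₂) ^ 2) (σ ^ 2)) (min τ₃ (δ / (‖c‖ + 1))), by positivity,
    fun A hA z hz0 hz => ?_⟩
  set t := √z with ht
  have htz : t ^ 2 = z := Real.sq_sqrt hz0
  have ht0 : 0 ≤ t := Real.sqrt_nonneg z
  have ht₁₂ : t ≤ min τ₁ τ₂ := (Real.sqrt_le_left (by positivity)).2
    (hz.trans ((min_le_left _ _).trans (min_le_left _ _)))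
  have htσ : t ≤ σ := (Real.sqrt_le_left (by positivity)).2
    (hz.trans ((min_le_left _ _).trans (min_le_right _ _)))
  have ht₁ : t ≤ τ₁ := ht₁₂.trans (min_le_left _ _)
  have ht₂ : t ≤ τ₂ := ht₁₂.trans (min_le_right _ _)
  have hz₃ : z ≤ τ₃ := hz.trans ((min_le_right _ _).trans (min_le_left _ _))
  have hzc : z * (‖c‖ + 1) ≤ δ :=
    (le_div_iff₀ (by positivity)).1 (hz.trans ((min_le_right _ _).trans (min_le_right _ _)))
  have htR : t * (4 * R) ≤ min δ (min ρ₁ ρ₂) := (le_div_iff₀ (by positivity)).1 htσ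
  have htδ : 4 * (t * R) ≤ δ := by linarith [min_le_left δ (min ρ₁ ρ₂)]
  have htρ₁ : 4 * (t * R) ≤ ρ₁ := by
    linarith [min_le_right δ (min ρ₁ ρ₂), min_le_left ρ₁ ρ₂]
  have htρ₂ : 4 * (t * R) ≤ ρ₂ := by
    linarith [min_le_right δ (min ρ₁ ρ₂), min_le_right ρ₁ ρ₂]
  have htR0 : 0 ≤ t * R := by positivity
  have hn₁ : ∀ P ∈ K', ‖p₁ P + ψ P • q₁‖ ≤ R := by
    intro P hP
    have e : ‖ψ P • q₁‖ ≤ |M| * ‖q₁‖ := by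
      rw [norm_smul]
      gcongr
      exact (hM P hP).trans (le_abs_self M)
    have e' : 0 ≤ |M| * ‖q₂‖ := by positivity
    have := norm_add_le (p₁ P) (ψ P • q₁)
    linarith [hC₁ P hP, le_abs_self C₁, abs_nonneg C₂]
  have hn₂ : ∀ P ∈ K', ‖p₂ P + ψ P • q₂‖ ≤ R := by
    intro P hP
    have e : ‖ψ P • q₂‖ ≤ |M| * ‖q₂‖ := by
      rw [norm_smul]
      gcongr
      exact (hM P hP).trans (le_abs_self M)
    have e' : 0 ≤ |M| * ‖q₁‖ := by positivity
    have := norm_add_le (p₂ P) (ψ P • q₂)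
    linarith [hC₂ P hP, le_abs_self C₂, abs_nonneg C₁]
  have hstep : ∀ (P v : E) (s : ℝ), |s| = t → ‖v‖ ≤ R → dist (P + s • v) P ≤ t * R := by
    intro P v s hs hv
    rw [dist_self_add_left, norm_smul, Real.norm_eq_abs, hs]
    gcongr
  have hmem : ∀ P, dist P A ≤ 4 * (t * R) → P ∈ K' := by
    intro P hP
    have := hadd A hA (P - A) (by rw [← dist_eq_norm]; linarith)
    rwa [add_sub_cancel] at this
  have habs : |t| = t := abs_of_nonneg ht0
  have habs' : |-t| = t := by rw [abs_neg, habs]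
  have hm₀ : A ∈ K' := hKK' hA
  obtain ⟨P₁, hP₁⟩ : ∃ P₁, P₁ = A + t • (p₁ A + ψ A • q₁) := ⟨_, rfl⟩
  have hd₁ : dist P₁ A ≤ t * R := hP₁ ▸ hstep A _ t habs (hn₁ A hm₀)
  have hm₁ : P₁ ∈ K' := hmem _ (by linarith)
  obtain ⟨P₂, hP₂⟩ : ∃ P₂, P₂ = P₁ + t • (p₂ P₁ + ψ P₁ • q₂) := ⟨_, rfl⟩
  have hd₂ : dist P₂ P₁ ≤ t * R := hP₂ ▸ hstep P₁ _ t habs (hn₂ P₁ hm₁)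
  have hd₂₀ := dist_triangle P₂ P₁ A
  have hm₂ : P₂ ∈ K' := hmem _ (by linarith)
  obtain ⟨P₃, hP₃⟩ : ∃ P₃, P₃ = P₂ + (-t) • (p₁ P₂ + ψ P₂ • q₁) := ⟨_, rfl⟩
  have hd₃ : dist P₃ P₂ ≤ t * R := hP₃ ▸ hstep P₂ _ (-t) habs' (hn₁ P₂ hm₂)
  have hd₃₀ := dist_triangle P₃ P₂ A
  have hd₃₁ := dist_triangle P₃ P₂ P₁
  have hm₃ : P₃ ∈ K' := hmem _ (by linarith)
  obtain ⟨P₄, hP₄⟩ : ∃ P₄, P₄ = P₃ + (-t) • (p₂ P₃ + ψ P₃ • q₂) := ⟨_, rfl⟩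
  have hP₄' := hloop A P₁ P₂ P₃ P₄ t _ _ _ _ hP₁ hP₂ hP₃ hP₄
  have x₁ := hx₁ A hm₀ t (by rwa [habs])
  have x₂ := hx₂ P₁ hm₁ t (by rwa [habs])
  have x₃ := hx₁ P₂ hm₂ (-t) (by rwa [habs'])
  have x₄ := hx₂ P₃ hm₃ (-t) (by rwa [habs'])
  rw [← hP₁, habs, abs_le] at x₁
  rw [← hP₂, habs, abs_le] at x₂
  rw [← hP₃, habs', abs_le] at x₃
  rw [← hP₄, habs', abs_le] at x₄
  have hg₁ : ∀ P ∈ K', |t * g₁ P| ≤ |G₁| * t := by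
    intro P hP
    rw [abs_mul, habs, mul_comm]
    exact mul_le_mul_of_nonneg_right ((hG₁ P hP).trans (le_abs_self _)) ht0
  have hg₂ : ∀ P ∈ K', |t * g₂ P| ≤ |G₂| * t := by
    intro P hP
    rw [abs_mul, habs, mul_comm]
    exact mul_le_mul_of_nonneg_right ((hG₂ P hP).trans (le_abs_self _)) ht0
  have k₁ := abs_le.1 (hg₁ A hm₀)
  have k₂ := abs_le.1 (hg₂ P₁ hm₁)
  have k₃ := abs_le.1 (hg₁ P₂ hm₂)
  have hDt : D * t = |G₁| * t + |G₂| * t + η / 4 * t := by rw [hD]; ring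
  have y₁ : |ψ A - ψ P₂| ≤ D * t := by
    rw [abs_le]
    constructor <;> linarith [x₁.1, x₁.2, x₂.1, x₂.2, k₁.1, k₁.2, k₂.1, k₂.2]
  have y₂ : |ψ P₁ - ψ P₃| ≤ D * t := by
    rw [abs_le]
    constructor <;> linarith [x₂.1, x₂.2, x₃.1, x₃.2, k₂.1, k₂.2, k₃.1, k₃.2]
  have hQ : A + z • c ∈ K' := by
    refine hadd A hA _ ?_
    rw [norm_smul, Real.norm_eq_abs, abs_of_nonneg hz0]
    linarith
  have y₃ := hx₃ _ hQ ![t * (ψ A - ψ P₂), t * (ψ P₁ - ψ P₃)] z hz0 hz₃ (by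
    intro i
    rw [← htz]
    fin_cases i
    · change |t * (ψ A - ψ P₂)| ≤ D * t ^ 2
      rw [abs_mul, habs]
      calc t * |ψ A - ψ P₂| ≤ t * (D * t) := by gcongr
        _ = D * t ^ 2 := by ring
    · change |t * (ψ P₁ - ψ P₃)| ≤ D * t ^ 2
      rw [abs_mul, habs]
      calc t * |ψ P₁ - ψ P₃| ≤ t * (D * t) := by gcongr
        _ = D * t ^ 2 := by ring)
  simp only [Fin.sum_univ_two, Matrix.cons_val_zero, Matrix.cons_val_one] at y₃
  rw [← htz, ← hP₄', htz, ← ht] at y₃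
  rcases ht0.eq_or_lt with h0 | hpos
  · have : z = 0 := by rw [← htz, ← h0]; norm_num
    simp [this, ← h0]
  have htR' : 0 < t * R := by positivity
  have z₁ := hu₁ A hm₀ P₂ hm₂ (by rw [dist_comm]; linarith)
  have z₂ := hu₂ P₁ hm₁ P₃ hm₃ (by rw [dist_comm]; linarith)
  rw [Real.dist_eq] at z₁ z₂
  have w₁ : |t * g₁ A - t * g₁ P₂| ≤ η / 8 * t := by
    rw [← mul_sub, abs_mul, habs, mul_comm]
    gcongr
  have w₂ : |t * g₂ P₁ - t * g₂ P₃| ≤ η / 8 * t := by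
    rw [← mul_sub, abs_mul, habs, mul_comm]
    gcongr
  have hηt : 0 ≤ η * t := by positivity
  rw [abs_le] at y₃ w₁ w₂ ⊢
  constructor <;> linarith [y₃.1, y₃.2, w₁.1, w₁.2, w₂.1, w₂.2, x₁.1, x₁.2, x₂.1, x₂.2,
    x₃.1, x₃.2, x₄.1, x₄.2]

/-- If the field `p + ψ q` differs from a constant `e` by a continuous combination of directions
of small `1/2`-Hölder oscillation, then `e` is such a direction too. -/
lemma littleHolder_of_eq_add_sum [ProperSpace E] [l.NeBot]
    (h : IsApproxSolution l F O ψ g p q) (hO : IsOpen O) {κ : Type*} [Fintype κ] {v : κ → E}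
    (hv : ∀ i, LittleHolder O ψ (v i)) {c : E → κ → ℝ} (hc : ContinuousOn c O) {e : E}
    (he : ∀ A, p A + ψ A • q = e + ∑ i, c A i • v i) : LittleHolder O ψ e := by
  intro K hK hcK η hη
  obtain ⟨K', hK', hc', hKK', δ, hδ, hadd⟩ := exists_compact_add_mem hO hK hcK
  obtain ⟨R, hR⟩ := hcK.exists_bound_of_continuousOn
    (h.continuous_p.continuousOn.add ((h.continuousOn_ψ.mono hK).smul continuousOn_const))
  obtain ⟨G, hG⟩ := hcK.exists_bound_of_continuousOn (h.continuousOn_g.mono hK)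
  obtain ⟨C, hC⟩ := hcK.exists_bound_of_continuousOn (hc.mono hK)
  obtain ⟨τ₁, hτ₁, h₁⟩ := h.expansion hO hK hcK one_pos
  obtain ⟨τ₂, hτ₂, h₂⟩ := LittleHolder.sum_of_le_mul hO v hv hK' hc'
    (show 0 < |C| + 1 by positivity) (half_pos hη)
  refine ⟨min (min τ₁ τ₂) (min (δ / (|R| + 1)) ((η / (2 * (|G| + 1))) ^ 2)), by positivity,
    fun A hA z hz => ?_⟩
  have hz₁ : |z| ≤ τ₁ := hz.trans ((min_le_left _ _).trans (min_le_left _ _))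
  have hz₂ : |z| ≤ τ₂ := hz.trans ((min_le_left _ _).trans (min_le_right _ _))
  have hz₃ : |z| * (|R| + 1) ≤ δ :=
    (le_div_iff₀ (by positivity)).1 (hz.trans ((min_le_right _ _).trans (min_le_left _ _)))
  have hz₄ : √|z| * (2 * (|G| + 1)) ≤ η := (le_div_iff₀ (by positivity)).1
    ((Real.sqrt_le_left (by positivity)).2
      (hz.trans ((min_le_right _ _).trans (min_le_right _ _))))
  have hB : A + z • (p A + ψ A • q) ∈ K' := by
    refine hadd A hA _ ?_
    rw [norm_smul, Real.norm_eq_abs]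
    calc |z| * ‖p A + ψ A • q‖ ≤ |z| * (|R| + 1) := by
          gcongr
          exact (hR A hA).trans (by linarith [le_abs_self R])
      _ ≤ δ := hz₃
  have e₁ := h₁ A hA z hz₁
  have e₂ := h₂ _ hB (fun i => -z * c A i) |z| (abs_nonneg z) hz₂ (fun i => by
    rw [abs_mul, abs_neg, mul_comm]
    gcongr
    have := (norm_le_pi_norm (c A) i).trans (hC A hA)
    rw [Real.norm_eq_abs] at this
    linarith [le_abs_self C])
  have heq : A + z • (p A + ψ A • q) + ∑ i, (-z * c A i) • v i = A + z • e := by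
    simp only [he, neg_mul, neg_smul, Finset.sum_neg_distrib, mul_smul, ← Finset.smul_sum]
    module
  rw [heq] at e₂
  have e₃ : |z * g A| ≤ |z| * |G| := by
    rw [abs_mul]
    exact mul_le_mul_of_nonneg_left ((hG A hA).trans (le_abs_self G)) (abs_nonneg z)
  have e₄ : |z| * (|G| + 1) ≤ η / 2 * √|z| := by
    nth_rw 1 [← Real.mul_self_sqrt (abs_nonneg z)]
    nlinarith [Real.sqrt_nonneg |z|]
  rw [abs_le] at e₁ e₂ e₃ ⊢
  constructor <;> linarith [e₁.1, e₁.2, e₂.1, e₂.2, e₃.1, e₃.2]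

end IsApproxSolution

end ApproxSolution

section HorizontalFields

variable {m n : ℕ} {b : Fin n → Matrix (Fin m) (Fin m) ℝ}

/-- The part of the vector field `D_j^ψ` that does not depend on `ψ`. -/
def horizontalField (b : Fin n → Matrix (Fin m) (Fin m) ℝ) (j : Fin (m - 1)) (A : W m n 1) :
    W m n 1 :=
  (Pi.single j 1, fun s => (1 / 2) * ∑ l, A.1 l * b s (idx1 m j) (idx1 m l))

/-- The vertical direction with components `b^s_{ik}`. -/
def verticalDir (b : Fin n → Matrix (Fin m) (Fin m) ℝ) (i k : Fin m) : W m n 1 :=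
  (0, fun s => b s i k)

lemma Dj_eq_fderiv (h0 : 0 < m) (ψ : W m n 1 → ℝ) (j : Fin (m - 1)) (A : W m n 1) :
    Dj m n h0 b ψ j A = fderiv ℝ ψ A
      (horizontalField b j A + ψ A • verticalDir b (idx1 m j) ⟨0, h0⟩) := by
  have : horizontalField b j A + ψ A • verticalDir b (idx1 m j) ⟨0, h0⟩ =
      ((Pi.single j 1 : Fin (m - 1) → ℝ), (0 : Fin n → ℝ)) +
      ∑ s, (ψ A * b s (idx1 m j) ⟨0, h0⟩ +
        (1 / 2) * ∑ l, A.1 l * b s (idx1 m j) (idx1 m l)) •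
      ((0 : Fin (m - 1) → ℝ), (Pi.single s 1 : Fin n → ℝ)) := by
    ext s
    · simp [horizontalField, verticalDir, Prod.fst_sum]
    · simp [horizontalField, verticalDir, Prod.snd_sum, Finset.sum_apply, Pi.single_apply,
        add_comm]
  rw [this, map_add, map_sum]
  simp only [map_smul, smul_eq_mul]
  rfl

lemma continuous_horizontalField (j : Fin (m - 1)) : Continuous (horizontalField b j) := by
  unfold horizontalField
  fun_prop

lemma horizontalField_add_smul (j k : Fin (m - 1)) (i l : Fin m) (A A' : W m n 1) (t z : ℝ) :
    horizontalField b j (A + t • horizontalField b k A' + z • verticalDir b i l) =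
      horizontalField b j A + (t / 2) • verticalDir b (idx1 m j) (idx1 m k) := by
  ext s
  · simp [horizontalField, verticalDir]
  · simp [horizontalField, verticalDir, add_mul, Finset.sum_add_distrib, Pi.single_apply]
    ring

lemma verticalDir_swap (hskew : ∀ s, (b s).transpose = -(b s)) (i k : Fin m) :
    verticalDir b k i = -verticalDir b i k := by
  ext s
  · simp [verticalDir]
  · exact congrFun (congrFun (hskew s) i) k

lemma verticalDir_self (hskew : ∀ s, (b s).transpose = -(b s)) (i : Fin m) :
    verticalDir b i i = 0 :=
  self_eq_neg.1 (verticalDir_swap hskew i i)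

lemma horizontalField_loop (hskew : ∀ s, (b s).transpose = -(b s)) (j l : Fin (m - 1))
    (i k i' k' : Fin m) (P₀ P₁ P₂ P₃ P₄ : W m n 1) (t a₀ a₁ a₂ a₃ : ℝ)
    (h₁ : P₁ = P₀ + t • (horizontalField b j P₀ + a₀ • verticalDir b i k))
    (h₂ : P₂ = P₁ + t • (horizontalField b l P₁ + a₁ • verticalDir b i' k'))
    (h₃ : P₃ = P₂ + (-t) • (horizontalField b j P₂ + a₂ • verticalDir b i k))
    (h₄ : P₄ = P₃ + (-t) • (horizontalField b l P₃ + a₃ • verticalDir b i' k')) :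
    P₄ = P₀ + t ^ 2 • verticalDir b (idx1 m l) (idx1 m j) +
      ((t * (a₀ - a₂)) • verticalDir b i k + (t * (a₁ - a₃)) • verticalDir b i' k') := by
  have e₁ := horizontalField_add_smul (b := b) l j i k P₀ P₀ t (t * a₀)
  have e₁' := horizontalField_add_smul (b := b) j j i k P₀ P₀ t (t * a₀)
  have e₂ := horizontalField_add_smul (b := b) j l i' k' P₁ P₁ t (t * a₁)
  have e₂' := horizontalField_add_smul (b := b) l l i' k' P₁ P₁ t (t * a₁)
  have e₃ := horizontalField_add_smul (b := b) l j i k P₂ P₂ (-t) (-t * a₂)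
  simp only [mul_smul, add_assoc, ← smul_add] at e₁ e₁' e₂ e₂' e₃
  rw [← h₁] at e₁ e₁'
  rw [← h₂] at e₂ e₂'
  rw [← h₃] at e₃
  rw [verticalDir_self hskew, smul_zero, add_zero] at e₁' e₂'
  rw [e₁] at h₂
  rw [e₂, e₁', verticalDir_swap hskew (idx1 m l) (idx1 m j)] at h₃
  rw [e₃, e₂', e₁] at h₄
  rw [h₄, h₃, h₂, h₁]
  module

lemma span_range_entries (hind : LinearIndependent ℝ b) :
    Submodule.span ℝ (range fun (x : Fin m × Fin m) (s : Fin n) => b s x.1 x.2) = ⊤ := by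
  by_contra h
  obtain ⟨f, hf, hker⟩ := Submodule.exists_le_ker_of_lt_top _ (lt_top_iff_ne_top.2 h)
  refine hf ((Pi.basisFun ℝ (Fin n)).ext fun s => ?_)
  refine Fintype.linearIndependent_iff.1 hind (fun s => f (Pi.basisFun ℝ (Fin n) s)) ?_ s
  ext i k
  have := hker (Submodule.subset_span (mem_range_self (i, k)))
  rw [LinearMap.mem_ker, ← (Pi.basisFun ℝ (Fin n)).sum_repr (fun s => b s i k), map_sum] at this
  simpa [Matrix.sum_apply, mul_comm] using this

variable {O : Set (W m n 1)} {ψ : W m n 1 → ℝ}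

lemma littleHolder_verticalDir {ι : Type*} {l : Filter ι} [l.NeBot] {F : ι → W m n 1 → ℝ}
    {g : Fin (m - 1) → W m n 1 → ℝ} (hskew : ∀ s, (b s).transpose = -(b s)) (hO : IsOpen O)
    (h0 : 0 < m) (h : ∀ j, IsApproxSolution l F O ψ (g j) (horizontalField b j)
      (verticalDir b (idx1 m j) ⟨0, h0⟩)) (i k : Fin m) :
    LittleHolder O ψ (verticalDir b i k) := by
  have hneg : ∀ {v : W m n 1}, LittleHolder O ψ v → LittleHolder O ψ (-v) := fun {v} hv =>
    LittleHolder.of_mem_span hO (fun _ : Unit => v) (fun _ => hv)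
      (neg_mem (Submodule.subset_span ⟨(), rfl⟩))
  have hidx : ∀ i : Fin m, i = ⟨0, h0⟩ ∨ ∃ j, i = idx1 m j := by
    rintro ⟨i, hi⟩
    rcases i with _ | i
    · exact Or.inl rfl
    · exact Or.inr ⟨⟨i, by omega⟩, rfl⟩
  have hfirst : ∀ j, LittleHolder O ψ (verticalDir b (idx1 m j) ⟨0, h0⟩) := fun j =>
    (h j).littleHolder hO
  rcases hidx i with rfl | ⟨j, rfl⟩ <;> rcases hidx k with rfl | ⟨l, rfl⟩
  · rw [verticalDir_self hskew]
    exact LittleHolder.of_mem_span hO (fun x : Empty => x.elim) (fun x => x.elim) (zero_mem _)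
  · rw [verticalDir_swap hskew]
    exact hneg (hfirst l)
  · exact hfirst j
  · refine LittleHolder.of_nonneg ?_ ?_
    · exact (h l).commutator (h j) hO (horizontalField_loop hskew l j _ _ _ _)
    · rw [← verticalDir_swap hskew]
      exact (h j).commutator (h l) hO (horizontalField_loop hskew j l _ _ _ _)

lemma littleHolder_of_forall_verticalDir (hind : LinearIndependent ℝ b) (hO : IsOpen O)
    (h : ∀ i k, LittleHolder O ψ (verticalDir b i k)) (y : Fin n → ℝ) :
    LittleHolder O ψ ((0, y) : W m n 1) := by
  refine LittleHolder.of_mem_span hO (fun x : Fin m × Fin m => verticalDir b x.1 x.2)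
    (fun x => h _ _) ?_
  have : (range fun x : Fin m × Fin m => verticalDir b x.1 x.2) =
      LinearMap.inr ℝ (Fin (m - 1) → ℝ) (Fin n → ℝ) ''
        range (fun (x : Fin m × Fin m) (s : Fin n) => b s x.1 x.2) := by
    rw [← range_comp]
    rfl
  rw [this, Submodule.span_image, span_range_entries hind]
  exact ⟨y, trivial, rfl⟩

lemma littleHolder_single_left {ι : Type*} {l : Filter ι} [l.NeBot] {F : ι → W m n 1 → ℝ}
    {g : W m n 1 → ℝ} {j : Fin (m - 1)} {i k : Fin m} (hO : IsOpen O)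
    (h : IsApproxSolution l F O ψ g (horizontalField b j) (verticalDir b i k))
    (hv : ∀ y : Fin n → ℝ, LittleHolder O ψ ((0, y) : W m n 1)) :
    LittleHolder O ψ ((Pi.single j 1, 0) : W m n 1) := by
  refine h.littleHolder_of_eq_add_sum hO (v := fun s : Fin n => ((0, Pi.single s 1) : W m n 1))
    (fun s => hv _)
    (c := fun A s => (1 / 2) * ∑ l, A.1 l * b s (idx1 m j) (idx1 m l) + ψ A * b s i k) ?_ ?_
  · have := h.continuousOn_ψ
    fun_prop
  · intro A
    ext s
    · simp [horizontalField, verticalDir, Prod.fst_sum]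
    · simp [horizontalField, verticalDir, Prod.snd_sum, Finset.sum_apply, Pi.single_apply]

lemma abs_le_enormP_left {d e : ℕ} (P : (Fin d → ℝ) × (Fin e → ℝ)) (i : Fin d) :
    |P.1 i| ≤ enormP P := by
  refine Real.abs_le_sqrt ?_
  have h₁ := Finset.single_le_sum (f := fun i => P.1 i ^ 2) (fun i _ => sq_nonneg _)
    (Finset.mem_univ i)
  have h₂ : 0 ≤ ∑ s, P.2 s ^ 2 := by positivity
  linarith

lemma abs_le_enormP_right {d e : ℕ} (P : (Fin d → ℝ) × (Fin e → ℝ)) (s : Fin e) :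
    |P.2 s| ≤ enormP P := by
  refine Real.abs_le_sqrt ?_
  have h₁ := Finset.single_le_sum (f := fun s => P.2 s ^ 2) (fun s _ => sq_nonneg _)
    (Finset.mem_univ s)
  have h₂ : 0 ≤ ∑ i, P.1 i ^ 2 := by positivity
  linarith

/-- A function of small `1/2`-Hölder oscillation in the coordinate directions has small
`1/2`-Hölder oscillation. -/
lemma LittleHolder.abs_sub_le_enormP {d e : ℕ} {O : Set ((Fin d → ℝ) × (Fin e → ℝ))}
    {ψ : (Fin d → ℝ) × (Fin e → ℝ) → ℝ} (hO : IsOpen O)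
    (hx : ∀ j, LittleHolder O ψ ((Pi.single j 1 : Fin d → ℝ), (0 : Fin e → ℝ)))
    (hy : ∀ s, LittleHolder O ψ ((0 : Fin d → ℝ), (Pi.single s 1 : Fin e → ℝ)))
    {K : Set ((Fin d → ℝ) × (Fin e → ℝ))} (hK : K ⊆ O) (hc : IsCompact K) {η : ℝ} (hη : 0 < η) :
    ∃ r > 0, ∀ A ∈ K, ∀ A', enormP (A - A') ≤ r → |ψ A - ψ A'| ≤ η * √(enormP (A - A')) := by
  obtain ⟨τ, hτ, h⟩ := LittleHolder.sum_of_le_mul hO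
    (Sum.elim (fun j => ((Pi.single j 1 : Fin d → ℝ), (0 : Fin e → ℝ)))
      (fun s => ((0 : Fin d → ℝ), (Pi.single s 1 : Fin e → ℝ))))
    (by rintro (j | s); exacts [hx j, hy s]) hK hc one_pos hη
  refine ⟨τ, hτ, fun A hA A' hAA' => ?_⟩
  have := h A hA (Sum.elim (fun j => -(A - A').1 j) (fun s => -(A - A').2 s)) (enormP (A - A'))
    (Real.sqrt_nonneg _) hAA' (by
      rintro (j | s)
      · simpa only [Sum.elim_inl, abs_neg, one_mul] using abs_le_enormP_left (A - A') j
      · simpa only [Sum.elim_inr, abs_neg, one_mul] using abs_le_enormP_right (A - A') s)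
  rw [abs_sub_comm]
  convert this using 4
  ext i
  · simp [Prod.fst_sum, Finset.sum_apply, Pi.single_apply]
  · simp [Prod.snd_sum, Finset.sum_apply, Pi.single_apply]

end HorizontalFields

/-- If `ψ ∈ C(𝒪)`, `w ∈ C(𝒪,ℝ^{m-1})` and there is a family
`(ψ_ε)_{ε∈(0,1)} ⊂ C¹(𝒪)` with `ψ_ε → ψ` and `D_j^{ψ_ε}ψ_ε → w_j` uniformly on
every compact subset of `𝒪` as `ε → 0⁺`, then `ψ ∈ h^{1/2}_loc(𝒪)`: on every
compact subset of `𝒪` the 1/2-Hölder ratios of `ψ` at scale `r` tend to `0` as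
`r → 0⁺`. -/
theorem statement13 (m n : ℕ) (hm : 2 ≤ m) (hn : 1 ≤ n)
    (b : Fin n → Matrix (Fin m) (Fin m) ℝ)
    (hskew : ∀ s, (b s).transpose = -(b s)) (hind : LinearIndependent ℝ b)
    (O : Set (W m n 1)) (hO : IsOpen O)
    (ψ : W m n 1 → ℝ) (hψ : ContinuousOn ψ O)
    (w : W m n 1 → Fin (m - 1) → ℝ) (hw : ContinuousOn w O)
    (ψε : ℝ → W m n 1 → ℝ)
    (hC1 : ∀ ε ∈ Set.Ioo (0:ℝ) 1, ContDiffOn ℝ 1 (ψε ε) O)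
    (hconv : ∀ K ⊆ O, IsCompact K →
      TendstoUniformlyOn ψε ψ (𝓝[>] (0:ℝ)) K ∧
      ∀ j : Fin (m - 1),
        TendstoUniformlyOn (fun ε => Dj m n (by omega) b (ψε ε) j)
          (fun A => w A j) (𝓝[>] (0:ℝ)) K) :
    ∀ K ⊆ O, IsCompact K → ∀ ε > 0, ∃ r > 0, ∀ A ∈ K, ∀ A' ∈ K,
      0 < enormP (A - A') → enormP (A - A') ≤ r →
      |ψ A - ψ A'| ≤ ε * Real.sqrt (enormP (A - A')) := by
  have h0 : 0 < m := by omega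
  have happrox : ∀ j, IsApproxSolution (𝓝[>] (0 : ℝ)) ψε O ψ (fun A => w A j)
      (horizontalField b j) (verticalDir b (idx1 m j) ⟨0, h0⟩) := fun j =>
    { continuous_p := continuous_horizontalField j
      p_add := fun A t z => by
        rw [horizontalField_add_smul, verticalDir_self hskew, smul_zero, add_zero]
      continuousOn_ψ := hψ
      continuousOn_g := (continuous_apply j).comp_continuousOn hw
      contDiffOn := by
        filter_upwards [Ioo_mem_nhdsGT one_pos] with ε hε using hC1 ε hε
      lim := fun K hK hc => (hconv K hK hc).1
      lim_deriv := fun K hK hc => by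
        simpa only [← Dj_eq_fderiv h0] using (hconv K hK hc).2 j }
  have hy := littleHolder_of_forall_verticalDir hind hO
    (littleHolder_verticalDir hskew hO h0 happrox)
  have hx := fun j => littleHolder_single_left hO (happrox j) hy
  intro K hK hc ε hε
  obtain ⟨r, hr, h⟩ := LittleHolder.abs_sub_le_enormP hO hx (fun s => hy _) hK hc hε
  exact ⟨r, hr, fun A hA A' _ _ hAA' => h A hA A' hAA'⟩

end Carnot
end
end

section
/- Let 𝒪 ⊂ ℝ^{m−1} × ℝ^n be open and let 𝒪' ⋐ 𝒪'' ⋐ 𝒪 be open sets with compact closures contained in the next set. Let M, N₀ > 0 and let β : (0,∞) → [0,∞) be increasing with β(r) → 0 as r → 0⁺. Then there exists α : (0,∞) → [0,∞) with α(r) → 0 as r → 0⁺ such that for EVERY ψ ∈ C¹(𝒪, ℝ) satisfying sup_{𝒪''} |ψ| ≤ M, sup_{𝒪''} |D_j^ψψ| ≤ N₀ for all j = 2,…,m, and |D_j^ψψ(A) − D_j^ψψ(A')| ≤ β(|A − A'|) for all A, A' ∈ 𝒪'' and all j, one has |ψ(A) − ψ(A')| ≤ α(|A − A'|)·|A − A'|^{1/2}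 for all A, A' ∈ 𝒪' with A ≠ A' (|·| being the Euclidean norm on ℝ^{m+n−1}). -/
noncomputable section

open Set Filter Topology MeasureTheory

namespace Carnot

section Abstract

open Metric
open scoped NNReal

/-- Existence for a scalar ODE whose right-hand side is bounded by `M`. -/
lemma exists_scalar_solution {f : ℝ → ℝ → ℝ} {M T : ℝ} {L : ℝ≥0} (hM : 0 ≤ M) (hT : 0 ≤ T)
    (hlip : ∀ t ∈ Icc 0 T, LipschitzOnWith L (f t) (Icc (-(M * T)) (M * T)))
    (hcont : ∀ q ∈ Icc (-(M * T)) (M * T), ContinuousOn (f · q) (Icc 0 T))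
    (hbound : ∀ t ∈ Icc 0 T, ∀ q ∈ Icc (-(M * T)) (M * T), |f t q| ≤ M) :
    ∃ p : ℝ → ℝ, p 0 = 0 ∧ ∀ t ∈ Icc 0 T, |p t| ≤ M * t ∧
      HasDerivWithinAt p (f t (p t)) (Icc 0 T) t := by
  have hMT : -(M * T) ≤ M * T := by have := mul_nonneg hM hT; linarith
  set g : ℝ → ℝ → ℝ := fun t q => f t (projIcc _ _ hMT q) with hg
  have hPL : IsPicardLindelof g (⟨0, le_rfl, hT⟩ : Icc (0 : ℝ) T) (0 : ℝ)
      (⟨M * T, mul_nonneg hM hT⟩ : ℝ≥0) 0 ⟨M, hM⟩ L := by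
    refine ⟨fun t ht => ?_, fun q _ => hcont _ (projIcc _ _ hMT q).2,
      fun t ht q _ => hbound t ht _ (projIcc _ _ hMT q).2, ?_⟩
    · have h1 : LipschitzWith 1 (fun q => (projIcc _ _ hMT q : ℝ)) :=
        LipschitzWith.projIcc hMT
      have h2 := (hlip t ht).comp (h1.lipschitzOnWith (s := closedBall 0 (M * T)))
        (fun q _ => (projIcc _ _ hMT q).2)
      rw [mul_one] at h2
      exact h2
    · simp only [sub_zero, sub_self, max_eq_left hT, NNReal.coe_zero]
      exact le_rfl
  obtain ⟨p, hp0, hp⟩ := hPL.exists_eq_forall_mem_Icc_hasDerivWithinAt₀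
  have hp0 : p 0 = 0 := hp0
  have hle : ∀ t ∈ Icc 0 T, |p t| ≤ M * t := by
    intro t ht
    have := norm_image_sub_le_of_norm_deriv_le_segment' hp
      (fun x hx => hbound x (Ico_subset_Icc_self hx) _ (projIcc _ _ hMT (p x)).2) t ht
    simpa [hp0] using this
  refine ⟨p, hp0, fun t ht => ⟨hle t ht, ?_⟩⟩
  have hmem : p t ∈ Icc (-(M * T)) (M * T) :=
    abs_le.1 ((hle t ht).trans (mul_le_mul_of_nonneg_left ht.2 hM))
  have hgp : g t (p t) = f t (p t) := by simp only [hg, projIcc_of_mem hMT hmem]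
  exact hgp ▸ hp t ht

/-- Solutions of a scalar ODE with Lipschitz right-hand side keep their order. -/
lemma scalar_solution_le {f : ℝ → ℝ → ℝ} {s : ℝ → Set ℝ} {T : ℝ} {L : ℝ≥0} {p q : ℝ → ℝ}
    (hT : 0 ≤ T) (hlip : ∀ t ∈ Icc 0 T, LipschitzOnWith L (f t) (s t))
    (hp : ∀ t ∈ Icc 0 T, p t ∈ s t ∧ HasDerivWithinAt p (f t (p t)) (Icc 0 T) t)
    (hq : ∀ t ∈ Icc 0 T, q t ∈ s t ∧ HasDerivWithinAt q (f t (q t)) (Icc 0 T) t)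
    (h0 : p 0 ≤ q 0) : p T ≤ q T := by
  by_contra! hlt
  have hpc : ContinuousOn p (Icc 0 T) := fun t ht => (hp t ht).2.continuousWithinAt
  have hqc : ContinuousOn q (Icc 0 T) := fun t ht => (hq t ht).2.continuousWithinAt
  obtain ⟨τ, hτ, hτ0⟩ := intermediate_value_Icc hT (hpc.sub hqc)
    (show (0 : ℝ) ∈ Icc (p 0 - q 0) (p T - q T) from ⟨by linarith, by linarith⟩)
  have hsub : Icc τ T ⊆ Icc 0 T := Icc_subset_Icc_left hτ.1
  have hder : ∀ {r : ℝ → ℝ}, (∀ t ∈ Icc 0 T, r t ∈ s t ∧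
      HasDerivWithinAt r (f t (r t)) (Icc 0 T) t) →
      ∀ t ∈ Ico τ T, HasDerivWithinAt r (f t (r t)) (Ici t) t := fun hr t ht =>
    (hr t (hsub (Ico_subset_Icc_self ht))).2.mono_of_mem_nhdsWithin
      (Icc_mem_nhdsGE_of_mem ⟨hτ.1.trans ht.1, ht.2⟩)
  have := ODE_solution_unique_of_mem_Icc_right
    (fun t ht => hlip t (hsub (Ico_subset_Icc_self ht)))
    (hpc.mono hsub) (hder hp) (fun t ht => (hp t (hsub (Ico_subset_Icc_self ht))).1)
    (hqc.mono hsub) (hder hq) (fun t ht => (hq t (hsub (Ico_subset_Icc_self ht))).1)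
    (sub_eq_zero.1 hτ0) ⟨hτ.2, le_rfl⟩
  exact hlt.ne' this

lemma norm_zero_prod {X Y : Type*} [SeminormedAddCommGroup X] [SeminormedAddCommGroup Y] (w : Y) :
    ‖((0 : X), w)‖ = ‖w‖ := by
  simp [Prod.norm_def]

variable {X Y : Type*} [NormedAddCommGroup X] [NormedSpace ℝ X]
  [NormedAddCommGroup Y] [NormedSpace ℝ Y]

/-- The vector fields `A ↦ (ζ, ψ(A) • V ζ + U A.1 ζ)` on a domain `Ω`, together with the constants
and the modulus of continuity controlling the functions `ψ`. -/
structure Frame (X Y : Type*) [NormedAddCommGroup X] [NormedSpace ℝ X]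
    [NormedAddCommGroup Y] [NormedSpace ℝ Y] where
  V : X →L[ℝ] Y
  U : X →L[ℝ] X →L[ℝ] Y
  Ω : Set (X × Y)
  M : ℝ
  N : ℝ
  K : ℝ
  ω : ℝ → ℝ
  skew : ∀ ξ η, U ξ η = -U η ξ
  isOpen : IsOpen Ω
  M_nonneg : 0 ≤ M
  N_nonneg : 0 ≤ N
  one_le_K : 1 ≤ K
  speed_le : ∀ A ∈ Ω, ∀ ζ, ‖ζ‖ ≤ 1 → M * ‖V ζ‖ + ‖U A.1 ζ‖ ≤ K
  ω_nonneg : ∀ r, 0 ≤ ω r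
  tendsto : Tendsto ω (𝓝[>] 0) (𝓝 0)

namespace Frame

variable (F : Frame X Y)

/-- The derivative of `ψ` along the vector field attached to `ψ` and `ζ`. -/
def ideriv (ψ : X × Y → ℝ) (ζ : X) (A : X × Y) : ℝ :=
  fderiv ℝ ψ A (ζ, ψ A • F.V ζ + F.U A.1 ζ)

/-- The `C¹` functions satisfying the bounds recorded in the frame. -/
structure Adm (ψ : X × Y → ℝ) : Prop where
  contDiffOn : ContDiffOn ℝ 1 ψ F.Ω
  abs_apply_le : ∀ A ∈ F.Ω, |ψ A| ≤ F.M
  ideriv_le : ∀ ζ, ∀ A ∈ F.Ω, |F.ideriv ψ ζ A| ≤ F.N * ‖ζ‖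
  ideriv_sub_le : ∀ ζ, ∀ A ∈ F.Ω, ∀ A' ∈ F.Ω, ∀ r > 0, ‖A - A'‖ ≤ r →
    |F.ideriv ψ ζ A - F.ideriv ψ ζ A'| ≤ F.ω r * ‖ζ‖

/-- The point reached from `A` at time `t` in the direction `ζ` when `ψ` has integral `q`. -/
def pt (A : X × Y) (ζ : X) (t q : ℝ) : X × Y :=
  (A.1 + t • ζ, A.2 + (q • F.V ζ + t • F.U A.1 ζ))

variable {F} {ψ : X × Y → ℝ} {A : X × Y} {ζ : X}

lemma ideriv_neg (ξ : X) : F.ideriv ψ (-ξ) A = -F.ideriv ψ ξ A := by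
  unfold ideriv
  rw [← map_neg]
  congr 1
  ext
  · simp
  · simp
    abel

lemma K_pos : 0 < F.K := one_pos.trans_le F.one_le_K

lemma pt_mem_closedBall {t T q : ℝ} (hA : A ∈ F.Ω) (hζ : ‖ζ‖ ≤ 1) (ht : 0 ≤ t) (htT : t ≤ T)
    (hq : |q| ≤ F.M * T) : F.pt A ζ t q ∈ closedBall A (F.K * T) := by
  rw [mem_closedBall, dist_eq_norm, pt, Prod.norm_def]
  have h0 : 0 ≤ T := ht.trans htT
  apply max_le
  · simp only [Prod.fst_sub, add_sub_cancel_left, norm_smul, Real.norm_eq_abs, abs_of_nonneg ht]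
    nlinarith [F.one_le_K, norm_nonneg ζ]
  · simp only [Prod.snd_sub, add_sub_cancel_left]
    calc _ ≤ |q| * ‖F.V ζ‖ + t * ‖F.U A.1 ζ‖ := by
          refine (norm_add_le _ _).trans ?_
          simp [norm_smul, abs_of_nonneg ht]
      _ ≤ (F.M * T) * ‖F.V ζ‖ + T * ‖F.U A.1 ζ‖ := by gcongr
      _ = (F.M * ‖F.V ζ‖ + ‖F.U A.1 ζ‖) * T := by ring
      _ ≤ _ := by gcongr; exact F.speed_le A hA ζ hζ

lemma Adm.exists_lipschitzOnWith [ProperSpace X] [ProperSpace Y] (hψ : F.Adm ψ) {r : ℝ}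
    (hr : closedBall A r ⊆ F.Ω) : ∃ L : ℝ≥0, LipschitzOnWith L ψ (closedBall A r) := by
  have hc : ContinuousOn (fderiv ℝ ψ) (closedBall A r) :=
    (hψ.contDiffOn.continuousOn_fderiv_of_isOpen F.isOpen le_rfl).mono hr
  obtain ⟨C, hC⟩ := (isCompact_closedBall A r).exists_bound_of_continuousOn hc
  refine ⟨C.toNNReal, (convex_closedBall A r).lipschitzOnWith_of_nnnorm_fderiv_le (𝕜 := ℝ)
    (fun x hx => (hψ.contDiffOn.differentiableOn one_ne_zero).differentiableAt
      (F.isOpen.mem_nhds (hr hx))) (fun x hx => ?_)⟩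
  rw [← NNReal.coe_le_coe]
  exact (hC x hx).trans (Real.le_coe_toNNReal C)

lemma lipschitzOnWith_pt {L : ℝ≥0} {S : Set (X × Y)} (hL : LipschitzOnWith L ψ S) (t : ℝ) :
    LipschitzOnWith (L * ‖F.V ζ‖₊) (fun q => ψ (F.pt A ζ t q)) {q | F.pt A ζ t q ∈ S} := by
  refine hL.comp (t := S) (LipschitzWith.lipschitzOnWith ?_) (fun q hq => hq)
  refine LipschitzWith.of_dist_le_mul fun q q' => ?_
  rw [dist_eq_norm, dist_eq_norm,
    show F.pt A ζ t q - F.pt A ζ t q' = ((0 : X), (q - q') • F.V ζ) by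
      ext <;> simp [pt, sub_smul]]
  simp only [Prod.norm_def, norm_zero, norm_smul, coe_nnnorm]
  rw [max_eq_right (by positivity), mul_comm]

lemma Adm.exists_trajectory [ProperSpace X] [ProperSpace Y] (hψ : F.Adm ψ) {T : ℝ} (hT : 0 ≤ T)
    (hA : closedBall A (F.K * T) ⊆ F.Ω) (hζ : ‖ζ‖ ≤ 1) :
    ∃ p : ℝ → ℝ, p 0 = 0 ∧ ∀ t ∈ Icc 0 T, |p t| ≤ F.M * t ∧
      HasDerivWithinAt p (ψ (F.pt A ζ t (p t))) (Icc 0 T) t := by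
  have hAΩ : A ∈ F.Ω := hA (mem_closedBall_self (mul_nonneg F.K_pos.le hT))
  obtain ⟨L, hL⟩ := hψ.exists_lipschitzOnWith hA
  have hmem : ∀ t ∈ Icc 0 T, ∀ q ∈ Icc (-(F.M * T)) (F.M * T),
      F.pt A ζ t q ∈ closedBall A (F.K * T) := fun t ht q hq =>
    pt_mem_closedBall hAΩ hζ ht.1 ht.2 (abs_le.2 hq)
  refine exists_scalar_solution F.M_nonneg hT
    (fun t ht => (lipschitzOnWith_pt hL t).mono (hmem t ht)) (fun q hq => ?_)
    (fun t ht q hq => hψ.abs_apply_le _ (hA (hmem t ht q hq)))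
  refine hL.continuousOn.comp (Continuous.continuousOn ?_) (fun t ht => hmem t ht q hq)
  unfold pt
  fun_prop

lemma U_self (ζ : X) : F.U ζ ζ = 0 := by
  have h := F.skew ζ ζ
  have h2 : (2 : ℝ) • F.U ζ ζ = 0 := by
    rw [two_smul]
    nth_rewrite 1 [h]
    exact neg_add_cancel _
  simpa using h2

lemma Adm.hasDerivWithinAt (hψ : F.Adm ψ) {p : ℝ → ℝ} {s : Set ℝ} {t : ℝ}
    (hmem : F.pt A ζ t (p t) ∈ F.Ω)
    (hp : HasDerivWithinAt p (ψ (F.pt A ζ t (p t))) s t) :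
    HasDerivWithinAt (fun t => ψ (F.pt A ζ t (p t)))
      (F.ideriv ψ ζ (F.pt A ζ t (p t))) s t := by
  have h1 : HasDerivWithinAt (fun t => F.pt A ζ t (p t))
      ((1 : ℝ) • ζ, ψ (F.pt A ζ t (p t)) • F.V ζ + (1 : ℝ) • F.U A.1 ζ) s t :=
    (((hasDerivWithinAt_id t s).smul_const ζ).const_add A.1).prodMk
      (((hp.smul_const (F.V ζ)).add
        ((hasDerivWithinAt_id t s).smul_const (F.U A.1 ζ))).const_add A.2)
  have h2 : DifferentiableAt ℝ ψ (F.pt A ζ t (p t)) :=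
    (hψ.contDiffOn.differentiableOn one_ne_zero).differentiableAt (F.isOpen.mem_nhds hmem)
  have h3 := h2.hasFDerivAt.comp_hasDerivWithinAt t h1
  have h4 : F.U (F.pt A ζ t (p t)).1 ζ = F.U A.1 ζ := by simp [pt, U_self]
  simpa [ideriv, h4, Function.comp_def] using h3

lemma Adm.exists_leg [ProperSpace X] [ProperSpace Y] (hψ : F.Adm ψ) {C : X × Y} {r ρ : ℝ}
    (hr : 0 < r) (hAC : ‖A - C‖ + F.K * r ≤ ρ) (hC : closedBall C ρ ⊆ F.Ω) (hζ : ‖ζ‖ ≤ 1) :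
    ∃ q, ‖F.pt A ζ r q - A‖ ≤ F.K * r ∧ |q - r * ψ A| ≤ F.N * r ^ 2 ∧
      |ψ (F.pt A ζ r q) - ψ A| ≤ F.N * r ∧
      |ψ (F.pt A ζ r q) - ψ A - r * F.ideriv ψ ζ C| ≤ r * F.ω ρ := by
  have hKr : 0 < F.K * r := mul_pos F.K_pos hr
  have hρ : 0 < ρ := by linarith [norm_nonneg (A - C)]
  have hball : closedBall A (F.K * r) ⊆ closedBall C ρ :=
    closedBall_subset_closedBall' (by rw [dist_eq_norm]; linarith)
  have hAC' : closedBall A (F.K * r) ⊆ F.Ω := hball.trans hC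
  have hA : A ∈ F.Ω := hAC' (mem_closedBall_self hKr.le)
  have hCΩ : C ∈ F.Ω := hC (mem_closedBall_self hρ.le)
  obtain ⟨p, hp0, hp⟩ := hψ.exists_trajectory hr.le hAC' hζ
  have hmem : ∀ t ∈ Icc 0 r, F.pt A ζ t (p t) ∈ closedBall A (F.K * r) := fun t ht =>
    pt_mem_closedBall hA hζ ht.1 ht.2
      ((hp t ht).1.trans (mul_le_mul_of_nonneg_left ht.2 F.M_nonneg))
  have hd : ∀ t ∈ Icc 0 r, HasDerivWithinAt (fun t => ψ (F.pt A ζ t (p t)))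
      (F.ideriv ψ ζ (F.pt A ζ t (p t))) (Icc 0 r) t := fun t ht =>
    hψ.hasDerivWithinAt (hAC' (hmem t ht)) (hp t ht).2
  have hpt0 : F.pt A ζ 0 (p 0) = A := by simp [pt, hp0]
  have hN : ∀ B ∈ F.Ω, |F.ideriv ψ ζ B| ≤ F.N := fun B hB =>
    (hψ.ideriv_le ζ B hB).trans (mul_le_of_le_one_right F.N_nonneg hζ)
  have hlin : ∀ t ∈ Icc 0 r, |ψ (F.pt A ζ t (p t)) - ψ A| ≤ F.N * t := by
    intro t ht
    have := norm_image_sub_le_of_norm_deriv_le_segment' hd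
      (fun s hs => hN _ (hAC' (hmem s (Ico_subset_Icc_self hs)))) t ht
    simpa [hpt0] using this
  have hrr : r ∈ Icc 0 r := ⟨hr.le, le_rfl⟩
  refine ⟨p r, mem_closedBall_iff_norm.1 (hmem r hrr), ?_, hlin r hrr, ?_⟩
  · have h1 : ∀ t ∈ Icc 0 r, HasDerivWithinAt (fun t => p t - t * ψ A)
        (ψ (F.pt A ζ t (p t)) - 1 * ψ A) (Icc 0 r) t := fun t ht =>
      (hp t ht).2.sub ((hasDerivWithinAt_id t _).mul_const (ψ A))
    have := norm_image_sub_le_of_norm_deriv_le_segment' (C := F.N * r) h1 (fun s hs => by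
      rw [one_mul]
      exact (hlin s (Ico_subset_Icc_self hs)).trans
        (mul_le_mul_of_nonneg_left hs.2.le F.N_nonneg)) r hrr
    simp only [hp0, zero_mul, sub_zero, Real.norm_eq_abs] at this
    exact this.trans_eq (by ring)
  · have h1 : ∀ t ∈ Icc 0 r, HasDerivWithinAt
        (fun t => ψ (F.pt A ζ t (p t)) - t * F.ideriv ψ ζ C)
        (F.ideriv ψ ζ (F.pt A ζ t (p t)) - 1 * F.ideriv ψ ζ C) (Icc 0 r) t := fun t ht =>
      (hd t ht).sub ((hasDerivWithinAt_id t _).mul_const _)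
    have hω : ∀ B ∈ closedBall C ρ, |F.ideriv ψ ζ B - F.ideriv ψ ζ C| ≤ F.ω ρ := fun B hB =>
      (hψ.ideriv_sub_le ζ B (hC hB) C hCΩ ρ hρ (mem_closedBall_iff_norm.1 hB)).trans
        (mul_le_of_le_one_right (F.ω_nonneg ρ) hζ)
    have := norm_image_sub_le_of_norm_deriv_le_segment' (C := F.ω ρ) h1 (fun s hs => by
      rw [one_mul]
      exact hω _ (hball (hmem s (Ico_subset_Icc_self hs)))) r hrr
    simp only [hpt0, zero_mul, sub_zero, Real.norm_eq_abs] at this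
    rw [mul_comm r (F.ω ρ)]
    convert this using 2
    ring

lemma pt_add_V (c t q : ℝ) :
    F.pt (A + ((0 : X), c • F.V ζ)) ζ t q = F.pt A ζ t (c + q) := by
  ext
  · simp [pt]
  · simp [pt, add_smul, add_assoc]

/-- Two trajectories starting on the same line of direction `V ζ` cannot cross, which bounds the
decay of `ψ` along this line. -/
lemma Adm.sub_le_of_noncrossing [ProperSpace X] [ProperSpace Y] (hψ : F.Adm ψ) {c T ρ : ℝ}
    (hc : 0 ≤ c) (hT : 0 < T) (hρ : F.K * T + c * ‖F.V ζ‖ ≤ ρ) (hA : closedBall A ρ ⊆ F.Ω)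
    (hζ : ‖ζ‖ ≤ 1) :
    ψ A - ψ (A + ((0 : X), c • F.V ζ)) ≤ c / T + F.ω (2 * ρ) * T := by
  set A' : X × Y := A + ((0 : X), c • F.V ζ) with hA'def
  have hKT : 0 < F.K * T := mul_pos F.K_pos hT
  have hcV : 0 ≤ c * ‖F.V ζ‖ := by positivity
  have hA'A : dist A' A = c * ‖F.V ζ‖ := by
    rw [dist_eq_norm, hA'def, add_sub_cancel_left, norm_zero_prod, norm_smul, Real.norm_eq_abs,
      abs_of_nonneg hc]
  have hb : closedBall A (F.K * T) ⊆ closedBall A ρ := closedBall_subset_closedBall (by linarith)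
  have hb' : closedBall A' (F.K * T) ⊆ closedBall A ρ :=
    closedBall_subset_closedBall' (by rw [hA'A]; exact hρ)
  obtain ⟨p, hp0, hp⟩ := hψ.exists_trajectory hT.le (hb.trans hA) hζ
  obtain ⟨q, hq0, hq⟩ := hψ.exists_trajectory hT.le (hb'.trans hA) hζ
  have hAΩ : A ∈ F.Ω := hA (mem_closedBall_self (by linarith))
  have hA'Ω : A' ∈ F.Ω := hA (hb' (mem_closedBall_self hKT.le))
  have hpm : ∀ t ∈ Icc 0 T, F.pt A ζ t (p t) ∈ closedBall A ρ := fun t ht =>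
    hb (pt_mem_closedBall hAΩ hζ ht.1 ht.2
      ((hp t ht).1.trans (mul_le_mul_of_nonneg_left ht.2 F.M_nonneg)))
  have hqm : ∀ t ∈ Icc 0 T, F.pt A' ζ t (q t) ∈ closedBall A ρ := fun t ht =>
    hb' (pt_mem_closedBall hA'Ω hζ ht.1 ht.2
      ((hq t ht).1.trans (mul_le_mul_of_nonneg_left ht.2 F.M_nonneg)))
  obtain ⟨L, hL⟩ := hψ.exists_lipschitzOnWith hA
  have hord : p T ≤ c + q T := by
    refine scalar_solution_le (q := fun t => c + q t) hT.le
      (fun t _ => lipschitzOnWith_pt (F := F) (A := A) (ζ := ζ) hL t)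
      (fun t ht => ⟨hpm t ht, (hp t ht).2⟩) (fun t ht => ⟨?_, ?_⟩) (by simp [hp0, hq0, hc])
    · have := hqm t ht
      rwa [hA'def, pt_add_V] at this
    · have := ((hq t ht).2).const_add c
      rwa [hA'def, pt_add_V] at this
  have hgap : ∀ t ∈ Icc 0 T, |(ψ (F.pt A' ζ t (q t)) - ψ (F.pt A ζ t (p t))) - (ψ A' - ψ A)|
      ≤ F.ω (2 * ρ) * T := by
    intro t ht
    have := norm_image_sub_le_of_norm_deriv_le_segment' (C := F.ω (2 * ρ))
      (f := fun t => ψ (F.pt A' ζ t (q t)) - ψ (F.pt A ζ t (p t)))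
      (fun s hs => (hψ.hasDerivWithinAt (hA (hqm s hs)) (hq s hs).2).sub
        (hψ.hasDerivWithinAt (hA (hpm s hs)) (hp s hs).2)) (fun s hs => by
      have hs := Ico_subset_Icc_self hs
      refine (hψ.ideriv_sub_le ζ _ (hA (hqm s hs)) _ (hA (hpm s hs)) (2 * ρ) (by linarith) ?_).trans
        (mul_le_of_le_one_right (F.ω_nonneg _) hζ)
      rw [← dist_eq_norm, two_mul]
      exact (dist_triangle_right _ _ A).trans (add_le_add (hqm s hs) (hpm s hs))) t ht
    simp only [show F.pt A' ζ 0 (q 0) = A' by simp [pt, hq0],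
      show F.pt A ζ 0 (p 0) = A by simp [pt, hp0], sub_zero, Real.norm_eq_abs] at this
    exact this.trans (mul_le_mul_of_nonneg_left ht.2 (F.ω_nonneg _))
  have hfin := norm_image_sub_le_of_norm_deriv_le_segment' (C := F.ω (2 * ρ) * T)
    (f := fun t => q t - p t - t * (ψ A' - ψ A))
    (fun s hs => ((hq s hs).2.sub (hp s hs).2).sub
      ((hasDerivWithinAt_id s _).mul_const (ψ A' - ψ A)))
    (fun s hs => by
      rw [one_mul]
      exact hgap s (Ico_subset_Icc_self hs)) T ⟨hT.le, le_rfl⟩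
  simp only [hp0, hq0, zero_mul, sub_zero, Real.norm_eq_abs] at hfin
  have h1 := (abs_le.1 hfin).2
  have h2 : (ψ A - ψ A') * T ≤ c + F.ω (2 * ρ) * T * T := by linarith
  rw [div_add' _ _ _ hT.ne', le_div_iff₀ hT]
  exact h2

lemma pt_loop (ξ η : X) (r q₁ q₂ q₃ q₄ : ℝ) :
    F.pt (F.pt (F.pt (F.pt A ξ r q₁) η r q₂) (-ξ) r q₃) (-η) r q₄ =
      A + ((0 : X), ((2 * r ^ 2) • F.U ξ η + (q₁ - q₃) • F.V ξ + (q₂ - q₄) • F.V η)) := by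
  have h := F.skew η ξ
  ext
  · simp [pt]
    abel
  · simp [pt, h, U_self]
    module

/-- Following the directions `ξ, η, -ξ, -η` moves a point by a multiple of `U ξ η`, up to vectors
in the span of `V ξ` and `V η`. -/
lemma Adm.exists_loop [ProperSpace X] [ProperSpace Y] (hψ : F.Adm ψ) {ξ η : X} {r ρ : ℝ}
    (hr : 0 < r) (hρ : 4 * (F.K * r) ≤ ρ) (hA : closedBall A ρ ⊆ F.Ω) (hξ : ‖ξ‖ ≤ 1)
    (hη : ‖η‖ ≤ 1) :
    ∃ a c : ℝ, |a| ≤ 4 * F.N * r ^ 2 ∧ |c| ≤ 4 * F.N * r ^ 2 ∧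
      ‖(2 * r ^ 2) • F.U ξ η + a • F.V ξ + c • F.V η‖ ≤ ρ ∧
      |ψ (A + ((0 : X), ((2 * r ^ 2) • F.U ξ η + a • F.V ξ + c • F.V η))) - ψ A|
        ≤ 4 * r * F.ω ρ := by
  have hKr : 0 < F.K * r := mul_pos F.K_pos hr
  obtain ⟨q₁, b₁, c₁, d₁, e₁⟩ := hψ.exists_leg (A := A) (C := A) hr
    (by rw [sub_self, norm_zero]; linarith) hA hξ
  set A₁ := F.pt A ξ r q₁
  obtain ⟨q₂, b₂, c₂, d₂, e₂⟩ := hψ.exists_leg (A := A₁) (C := A) hr (by linarith) hA hη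
  set A₂ := F.pt A₁ η r q₂ with hA₂
  have n₂ := norm_sub_le_norm_sub_add_norm_sub A₂ A₁ A
  obtain ⟨q₃, b₃, c₃, d₃, e₃⟩ := hψ.exists_leg (A := A₂) (C := A) (ζ := -ξ) hr
    (by linarith) hA (by rwa [norm_neg])
  set A₃ := F.pt A₂ (-ξ) r q₃ with hA₃
  have n₃ := norm_sub_le_norm_sub_add_norm_sub A₃ A₂ A
  obtain ⟨q₄, b₄, c₄, d₄, e₄⟩ := hψ.exists_leg (A := A₃) (C := A) (ζ := -η) hr
    (by linarith) hA (by rwa [norm_neg])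
  have n₄ := norm_sub_le_norm_sub_add_norm_sub (F.pt A₃ (-η) r q₄) A₃ A
  have hloop := pt_loop (F := F) (A := A) ξ η r q₁ q₂ q₃ q₄
  have hω := F.ω_nonneg ρ
  have hmul : ∀ x, |x| ≤ F.N * r → |r * x| ≤ F.N * r ^ 2 := fun x hx => by
    rw [abs_mul, abs_of_pos hr]
    nlinarith
  have hm₁ := hmul _ d₁
  have hm₂ := hmul _ d₂
  have hm₃ := hmul _ d₃
  rw [abs_le] at hm₁ hm₂ hm₃ c₁ c₂ c₃ c₄
  refine ⟨q₁ - q₃, q₂ - q₄, abs_le.2 ⟨by linarith, by linarith⟩,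
    abs_le.2 ⟨by linarith, by linarith⟩, ?_, ?_⟩
  · rw [← norm_zero_prod (X := X), ← add_sub_cancel_left A ((0 : X), _), ← hloop]
    linarith
  · rw [← hloop]
    rw [ideriv_neg] at e₃ e₄
    rw [abs_le] at e₁ e₂ e₃ e₄ ⊢
    constructor <;> linarith

variable (F) in
/-- The admissible functions are uniformly little-`1/2`-Hölder in the direction `w`. -/
def LittleHolder (w : Y) : Prop :=
  ∀ δ > 0, ∀ ε > 0, ∀ᶠ t in 𝓝 (0 : ℝ), ∀ ψ, F.Adm ψ → ∀ A, closedBall A δ ⊆ F.Ω →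
    |ψ (A + ((0 : X), t • w)) - ψ A| ≤ ε * √|t|

lemma LittleHolder.of_pos {w : Y}
    (h : ∀ v, v = w ∨ v = -w → ∀ δ > 0, ∀ ε > 0, ∀ᶠ t in 𝓝 (0 : ℝ), 0 < t → ∀ ψ, F.Adm ψ → ∀ A,
      closedBall A δ ⊆ F.Ω → |ψ (A + ((0 : X), t • v)) - ψ A| ≤ ε * √t) :
    F.LittleHolder w := by
  intro δ hδ ε hε
  have hneg : Tendsto (fun t : ℝ => -t) (𝓝 0) (𝓝 0) := by
    simpa using (continuous_neg (G := ℝ)).tendsto 0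
  filter_upwards [h w (.inl rfl) δ hδ ε hε, hneg.eventually (h (-w) (.inr rfl) δ hδ ε hε)]
    with t h₁ h₂ ψ hψ A hA
  rcases lt_trichotomy t 0 with ht | rfl | ht
  · have := h₂ (by linarith) ψ hψ A hA
    rwa [neg_smul_neg, ← abs_of_neg ht] at this
  · have : A + ((0 : X), (0 : ℝ) • w) = A := by ext <;> simp
    rw [this, sub_self, abs_zero]
    positivity
  · rw [abs_of_pos ht]
    exact h₁ ht ψ hψ A hA

lemma closedBall_add_subset {B : X × Y} {w : Y} {δ δ' : ℝ} (hA : closedBall A δ ⊆ F.Ω)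
    (hB : ‖B - A‖ ≤ δ') (hw : δ' + ‖w‖ ≤ δ - δ') :
    closedBall (B + ((0 : X), w)) δ' ⊆ F.Ω := by
  refine (closedBall_subset_closedBall' ?_).trans hA
  have h : dist (B + ((0 : X), w)) B = ‖w‖ := by
    rw [dist_eq_norm, add_sub_cancel_left, norm_zero_prod]
  have h' := dist_triangle (B + ((0 : X), w)) B A
  rw [h, dist_eq_norm B A] at h'
  linarith

lemma littleHolder_zero : F.LittleHolder 0 := by
  refine fun δ hδ ε hε => Eventually.of_forall fun t ψ hψ A hA => ?_
  have : A + ((0 : X), t • (0 : Y)) = A := by ext <;> simp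
  rw [this, sub_self, abs_zero]
  positivity

lemma eventually_norm_smul_lt (w : Y) {δ : ℝ} (hδ : 0 < δ) : ∀ᶠ t in 𝓝 (0 : ℝ), ‖t • w‖ < δ := by
  have : Tendsto (fun t : ℝ => ‖t • w‖) (𝓝 0) (𝓝 0) := by
    simpa using (show Continuous fun t : ℝ => ‖t • w‖ by fun_prop).tendsto 0
  exact this.eventually_lt_const hδ

lemma LittleHolder.add {w w' : Y} (hw : F.LittleHolder w) (hw' : F.LittleHolder w') :
    F.LittleHolder (w + w') := by
  intro δ hδ ε hε
  filter_upwards [hw δ hδ (ε / 2) (by positivity),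
    hw' (δ / 4) (by positivity) (ε / 2) (by positivity),
    eventually_norm_smul_lt w (show 0 < δ / 4 by positivity)] with t h₁ h₂ h₃ ψ hψ A hA
  have h₄ := h₁ ψ hψ A hA
  have h₅ := h₂ ψ hψ (A + ((0 : X), t • w)) (closedBall_add_subset hA
    (by rw [sub_self, norm_zero]; positivity) (by linarith))
  have h₆ : A + ((0 : X), t • (w + w')) = A + ((0 : X), t • w) + ((0 : X), t • w') := by
    ext <;> simp [add_assoc]
  rw [h₆]
  linarith [abs_sub_le (ψ (A + ((0 : X), t • w) + ((0 : X), t • w'))) (ψ (A + ((0 : X), t • w)))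
    (ψ A)]

lemma LittleHolder.smul {w : Y} (c : ℝ) (hw : F.LittleHolder w) : F.LittleHolder (c • w) := by
  intro δ hδ ε hε
  have hlim : Tendsto (fun t : ℝ => t * c) (𝓝 0) (𝓝 0) := by
    simpa using (continuous_mul_const c).tendsto 0
  filter_upwards [hlim.eventually (hw δ hδ (ε / (√|c| + 1)) (by positivity))] with t h ψ hψ A hA
  rw [smul_smul]
  refine (h ψ hψ A hA).trans ?_
  rw [abs_mul, Real.sqrt_mul (abs_nonneg t), div_mul_eq_mul_div, div_le_iff₀ (by positivity)]
  nlinarith [mul_nonneg hε.le (Real.sqrt_nonneg |t|)]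

variable (F) in
/-- The directions in which admissible functions are uniformly little-`1/2`-Hölder. -/
def littleHolderSubmodule : Submodule ℝ Y where
  carrier := {w | F.LittleHolder w}
  add_mem' := LittleHolder.add
  zero_mem' := littleHolder_zero
  smul_mem' c _ := LittleHolder.smul c

lemma exists_ω_le {ε δ : ℝ} (hε : 0 < ε) (hδ : 0 < δ) : ∃ ρ > 0, ρ ≤ δ ∧ F.ω ρ ≤ ε := by
  have h := (F.tendsto.eventually_le_const hε).and (Ioc_mem_nhdsGT hδ)
  obtain ⟨ρ, h₁, h₂⟩ := h.exists
  exact ⟨ρ, h₂.1, h₂.2, h₁⟩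

lemma littleHolder_V [ProperSpace X] [ProperSpace Y] (hζ : ‖ζ‖ ≤ 1) : F.LittleHolder (F.V ζ) := by
  suffices h : ∀ ζ : X, ‖ζ‖ ≤ 1 → ∀ δ > 0, ∀ ε > 0, ∀ᶠ t in 𝓝 (0 : ℝ), 0 < t → ∀ ψ, F.Adm ψ →
      ∀ A, closedBall A δ ⊆ F.Ω → ψ A - ψ (A + ((0 : X), t • F.V ζ)) ≤ ε * √t by
    refine .of_pos fun v hv δ hδ ε hε => ?_
    obtain ⟨ξ, hξ, rfl⟩ : ∃ ξ : X, ‖ξ‖ ≤ 1 ∧ v = F.V ξ := by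
      rcases hv with rfl | rfl
      · exact ⟨ζ, hζ, rfl⟩
      · exact ⟨-ζ, by rwa [norm_neg], (map_neg _ _).symm⟩
    filter_upwards [h ξ hξ δ hδ ε hε, h (-ξ) (by rwa [norm_neg]) (δ / 4) (by positivity) ε hε,
      eventually_norm_smul_lt (F.V ξ) (show 0 < δ / 4 by positivity)] with t h₁ h₂ h₃ ht ψ hψ A hA
    have h₄ := h₁ ht ψ hψ A hA
    have h₅ := h₂ ht ψ hψ (A + ((0 : X), t • F.V ξ)) (closedBall_add_subset hA
      (by rw [sub_self, norm_zero]; positivity) (by linarith))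
    have h₆ : A + ((0 : X), t • F.V ξ) + ((0 : X), t • F.V (-ξ)) = A := by ext <;> simp
    rw [h₆] at h₅
    exact abs_le.2 ⟨by linarith, h₅⟩
  intro ζ hζ δ hδ ε hε
  obtain ⟨ρ, hρ0, hρδ, hρ⟩ := F.exists_ω_le (show 0 < ε ^ 2 / 4 by positivity)
    (show 0 < 2 * δ by positivity)
  have hlim : Tendsto (fun t : ℝ => F.K * (2 / ε * √t) + t * ‖F.V ζ‖) (𝓝 0) (𝓝 0) := by
    simpa using (show Continuous fun t : ℝ => F.K * (2 / ε * √t) + t * ‖F.V ζ‖ by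
      fun_prop).tendsto 0
  filter_upwards [hlim.eventually_lt_const (show 0 < ρ / 2 by positivity)] with t ht ht0 ψ hψ A hA
  have hs : 0 < √t := Real.sqrt_pos.2 ht0
  refine (hψ.sub_le_of_noncrossing (T := 2 / ε * √t) ht0.le (by positivity) ht.le
    ((closedBall_subset_closedBall (by linarith)).trans hA) hζ).trans ?_
  rw [mul_div_cancel₀ ρ two_ne_zero]
  have h₁ : t / (2 / ε * √t) = ε / 2 * √t := by
    rw [div_eq_iff (by positivity)]
    field_simp
    exact (Real.sq_sqrt ht0.le).symm
  have h₂ : F.ω ρ * (2 / ε * √t) ≤ ε ^ 2 / 4 * (2 / ε * √t) := by gcongr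
  have h₃ : ε ^ 2 / 4 * (2 / ε * √t) = ε / 2 * √t := by
    field_simp
    ring
  linarith

lemma littleHolder_U [ProperSpace X] [ProperSpace Y] {ξ η : X} (hξ : ‖ξ‖ ≤ 1) (hη : ‖η‖ ≤ 1) :
    F.LittleHolder (F.U ξ η) := by
  suffices h : ∀ ξ : X, ‖ξ‖ ≤ 1 → ∀ δ > 0, ∀ ε > 0, ∀ᶠ t in 𝓝 (0 : ℝ), 0 < t → ∀ ψ, F.Adm ψ →
      ∀ A, closedBall A δ ⊆ F.Ω → |ψ (A + ((0 : X), t • F.U ξ η)) - ψ A| ≤ ε * √t by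
    refine .of_pos fun v hv δ hδ ε hε => ?_
    rcases hv with rfl | rfl
    · exact h ξ hξ δ hδ ε hε
    · have := h (-ξ) (by rwa [norm_neg]) δ hδ ε hε
      simpa using this
  intro ξ hξ δ hδ ε hε
  have hN := F.N_nonneg
  set C : ℝ := √(2 * F.N) with hC
  have hC0 : 0 ≤ C := Real.sqrt_nonneg _
  obtain ⟨ρ, hρ0, hρδ, hρ⟩ := F.exists_ω_le (show 0 < ε / 8 by positivity)
    (show 0 < δ / 8 by positivity)
  have hV : ∀ ζ : X, ‖ζ‖ ≤ 1 → ∃ τ > 0, ∀ s, |s| < τ → ‖s • F.V ζ‖ < δ / 4 ∧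
      ∀ ψ, F.Adm ψ → ∀ A, closedBall A (δ / 4) ⊆ F.Ω →
        |ψ (A + ((0 : X), s • F.V ζ)) - ψ A| ≤ ε / (4 * (C + 1)) * √|s| := fun ζ hζ => by
    have := (eventually_norm_smul_lt (F.V ζ) (show 0 < δ / 4 by positivity)).and
      (littleHolder_V (F := F) hζ (δ / 4) (by positivity) (ε / (4 * (C + 1))) (by positivity))
    obtain ⟨τ, hτ, h⟩ := Metric.eventually_nhds_iff.1 this
    exact ⟨τ, hτ, fun s hs => h (by simpa [Real.dist_eq] using hs)⟩
  obtain ⟨τ₁, hτ₁, h₁⟩ := hV ξ hξ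
  obtain ⟨τ₂, hτ₂, h₂⟩ := hV η hη
  have hlim : Tendsto (fun t : ℝ => 4 * (F.K * √(t / 2))) (𝓝 0) (𝓝 0) := by
    simpa using (show Continuous fun t : ℝ => 4 * (F.K * √(t / 2)) by fun_prop).tendsto 0
  have hlim' : Tendsto (fun t : ℝ => 2 * F.N * t) (𝓝 0) (𝓝 0) := by
    simpa using (continuous_const_mul (2 * F.N)).tendsto 0
  filter_upwards [hlim.eventually_lt_const hρ0, hlim'.eventually_lt_const hτ₁,
    hlim'.eventually_lt_const hτ₂] with t ht ht₁ ht₂ ht0 ψ hψ A hA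
  set r := √(t / 2) with hr
  have hr0 : 0 < r := Real.sqrt_pos.2 (by positivity)
  have hr2 : 2 * r ^ 2 = t := by rw [hr, Real.sq_sqrt (by positivity)]; ring
  have hrt : r ≤ √t := Real.sqrt_le_sqrt (by linarith)
  obtain ⟨a, c, ha, hc, hn, hl⟩ := hψ.exists_loop hr0 ht.le
    ((closedBall_subset_closedBall (by linarith)).trans hA) hξ hη
  have ha' : |a| ≤ 2 * F.N * t := by rw [← hr2]; linarith
  have hc' : |c| ≤ 2 * F.N * t := by rw [← hr2]; linarith
  rw [hr2] at hn hl
  set w := t • F.U ξ η + a • F.V ξ + c • F.V η with hw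
  obtain ⟨hc₁, hc₂⟩ := h₂ (-c) (by rw [abs_neg]; linarith)
  obtain ⟨ha₁, ha₂⟩ := h₁ (-a) (by rw [abs_neg]; linarith)
  have k₁ := hc₂ ψ hψ (A + ((0 : X), w)) (closedBall_add_subset hA
    (by rw [sub_self, norm_zero]; positivity) (by linarith))
  have k₂ := ha₂ ψ hψ (A + ((0 : X), w) + ((0 : X), (-c) • F.V η)) (closedBall_add_subset hA
    (by rw [add_sub_cancel_left, norm_zero_prod]; linarith) (by linarith))
  have k₃ : A + ((0 : X), w) + ((0 : X), (-c) • F.V η) + ((0 : X), (-a) • F.V ξ) =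
      A + ((0 : X), t • F.U ξ η) := by
    ext
    · simp
    · simp [hw]
      abel
  rw [k₃] at k₂
  have hsq : ∀ s, |s| ≤ 2 * F.N * t → ε / (4 * (C + 1)) * √|(-s)| ≤ ε / 4 * √t := by
    intro s hs
    have : √|(-s)| ≤ C * √t := by
      rw [abs_neg, hC, ← Real.sqrt_mul (by positivity)]
      exact Real.sqrt_le_sqrt hs
    rw [div_mul_eq_mul_div, div_le_iff₀ (by positivity)]
    nlinarith [mul_nonneg hε.le (Real.sqrt_nonneg t), mul_le_mul_of_nonneg_left this hε.le]
  have l₁ := hsq a ha'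
  have l₂ := hsq c hc'
  have l₃ : 4 * r * F.ω ρ ≤ 4 * √t * (ε / 8) := by
    have := F.ω_nonneg ρ
    gcongr
  have m₁ := abs_sub_le (ψ (A + ((0 : X), t • F.U ξ η)))
    (ψ (A + ((0 : X), w) + ((0 : X), (-c) • F.V η))) (ψ A)
  have m₂ := abs_sub_le (ψ (A + ((0 : X), w) + ((0 : X), (-c) • F.V η)))
    (ψ (A + ((0 : X), w))) (ψ A)
  linarith

lemma exists_forall_sub_sum_le {ι : Type*} (S : Finset ι) {e : ι → Y}
    (he : ∀ s, F.LittleHolder (e s)) {δ ε : ℝ} (hδ : 0 < δ) (hε : 0 < ε) :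
    ∃ ρ > 0, ∀ τ ≤ ρ, ∀ c : ι → ℝ, (∀ s, |c s| ≤ τ) → ∀ ψ, F.Adm ψ → ∀ A,
      closedBall A δ ⊆ F.Ω → |ψ (A + ((0 : X), ∑ s ∈ S, c s • e s)) - ψ A| ≤ ε * √τ := by
  induction S using Finset.cons_induction generalizing δ ε with
  | empty =>
    refine ⟨1, one_pos, fun τ _ c _ ψ _ A _ => ?_⟩
    rw [Finset.sum_empty, ← Prod.zero_eq_mk, add_zero, sub_self, abs_zero]
    positivity
  | cons a S ha ih =>
    obtain ⟨ρ, hρ, h₁⟩ := ih (show 0 < δ / 4 by positivity) (show 0 < ε / 2 by positivity)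
    obtain ⟨ρ', hρ', h₂⟩ := Metric.eventually_nhds_iff.1
      ((he a δ hδ (ε / 2) (by positivity)).and
        (eventually_norm_smul_lt (e a) (show 0 < δ / 4 by positivity)))
    refine ⟨min ρ (ρ' / 2), by positivity, fun τ hτ c hc ψ hψ A hA => ?_⟩
    obtain ⟨h₃, h₄⟩ := @h₂ (c a) (by
      rw [Real.dist_eq, sub_zero]
      linarith [hc a, hτ.trans (min_le_right _ _)])
    have h₅ := h₃ ψ hψ A hA
    have h₆ := h₁ τ (hτ.trans (min_le_left _ _)) c hc ψ hψ (A + ((0 : X), c a • e a))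
      (closedBall_add_subset hA (by rw [sub_self, norm_zero]; positivity) (by linarith))
    have h₇ : √|c a| ≤ √τ := Real.sqrt_le_sqrt (hc a)
    have h₉ : A + ((0 : X), c a • e a) + ((0 : X), ∑ s ∈ S, c s • e s) =
        A + ((0 : X), ∑ s ∈ Finset.cons a S ha, c s • e s) := by
      rw [add_assoc, Prod.mk_add_mk (0 : X), add_zero, Finset.sum_cons]
    rw [h₉] at h₆
    have h₈ : ε / 2 * √|c a| ≤ ε / 2 * √τ := by gcongr
    linarith [abs_sub_le (ψ (A + ((0 : X), ∑ s ∈ Finset.cons a S ha, c s • e s)))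
      (ψ (A + ((0 : X), c a • e a))) (ψ A)]

/-- If admissible functions are little-Hölder in all vertical directions, they are little-Hölder. -/
theorem exists_forall_sub_le {ι : Type*} [Fintype ι] [DecidableEq ι] [ProperSpace X]
    {F : Frame X (ι → ℝ)} (hF : ∀ w, F.LittleHolder w) {δ ε : ℝ} (hδ : 0 < δ) (hε : 0 < ε) :
    ∃ ρ > 0, ∀ ψ, F.Adm ψ → ∀ A A', closedBall A δ ⊆ F.Ω → ‖A' - A‖ ≤ ρ →
      |ψ A' - ψ A| ≤ ε * √‖A' - A‖ := by
  have hN := F.N_nonneg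
  have hK := F.K_pos
  obtain ⟨ρ, hρ, h⟩ := exists_forall_sub_sum_le Finset.univ
    (fun s => hF (Pi.single s 1)) (show 0 < δ / 2 by positivity)
    (show 0 < ε / (2 * √(1 + F.K)) by positivity)
  have hlim : Tendsto (fun d : ℝ => F.N * √d) (𝓝[>] 0) (𝓝 0) := by
    have : Tendsto (fun d : ℝ => F.N * √d) (𝓝 0) (𝓝 0) := by
      simpa using (show Continuous fun d : ℝ => F.N * √d by fun_prop).tendsto 0
    exact this.mono_left nhdsWithin_le_nhds
  obtain ⟨σ, hσ, hσ0⟩ := ((hlim.eventually_le_const (show 0 < ε / 2 by positivity)).and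
    self_mem_nhdsWithin).exists
  have hσ0 : 0 < σ := hσ0
  refine ⟨min (ρ / (1 + F.K)) (min σ (δ / (2 * F.K))), by positivity,
    fun ψ hψ A A' hA hd => ?_⟩
  set d := ‖A' - A‖ with hd_def
  have hd0 : 0 ≤ d := norm_nonneg _
  have hdρ : (1 + F.K) * d ≤ ρ := by
    have := hd.trans (min_le_left _ _)
    rwa [le_div_iff₀' (by positivity)] at this
  have hdσ : F.N * √d ≤ ε / 2 := by
    refine le_trans ?_ hσ
    have := hd.trans ((min_le_right _ _).trans (min_le_left _ _))
    gcongr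
  have hdδ : F.K * d ≤ δ / 2 := by
    have := hd.trans ((min_le_right _ _).trans (min_le_right _ _))
    rw [le_div_iff₀ (by positivity)] at this
    linarith
  obtain ⟨B, hB₁, hB₂, hB₃⟩ : ∃ B : X × (ι → ℝ), B.1 = A'.1 ∧ ‖B - A‖ ≤ F.K * d ∧
      |ψ B - ψ A| ≤ F.N * d := by
    rcases eq_or_ne A'.1 A.1 with h0 | h0
    · exact ⟨A, h0.symm, by rw [sub_self, norm_zero]; positivity,
        by rw [sub_self, abs_zero]; positivity⟩
    · have hr : 0 < ‖A'.1 - A.1‖ := norm_pos_iff.2 (sub_ne_zero.2 h0)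
      have hrd : ‖A'.1 - A.1‖ ≤ d := norm_fst_le (A' - A)
      have hKr := mul_le_mul_of_nonneg_left hrd hK.le
      obtain ⟨q, h₁, -, h₂, -⟩ := hψ.exists_leg (A := A) (C := A) (ρ := δ)
        (ζ := ‖A'.1 - A.1‖⁻¹ • (A'.1 - A.1)) hr
        (by rw [sub_self, norm_zero]; linarith) hA
        (by rw [norm_smul, norm_inv, norm_norm, inv_mul_cancel₀ hr.ne'])
      refine ⟨_, ?_, h₁.trans hKr, h₂.trans (by gcongr)⟩
      simp [pt, smul_smul, mul_inv_cancel₀ hr.ne']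
  have hw : ‖A' - B‖ ≤ (1 + F.K) * d := by
    have := norm_sub_le_norm_sub_add_norm_sub A' A B
    rw [norm_sub_rev A B] at this
    linarith
  have hA' : A' = B + ((0 : X), ∑ s, (A' - B).2 s • Pi.single s (1 : ℝ)) := by
    rw [pi_eq_sum_univ' (A' - B).2]
    ext <;> simp [hB₁, Pi.single_apply]
  have hc : ∀ s, |(A' - B).2 s| ≤ (1 + F.K) * d := fun s =>
    ((norm_le_pi_norm (A' - B).2 s).trans (norm_snd_le _)).trans hw
  have h₁ := h _ hdρ _ hc ψ hψ B ((closedBall_subset_closedBall' (by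
    rw [dist_eq_norm]; linarith)).trans hA)
  rw [← hA', Real.sqrt_mul (by positivity)] at h₁
  have h₂ : ε / (2 * √(1 + F.K)) * (√(1 + F.K) * √d) = ε / 2 * √d := by field_simp
  have h₃ : F.N * d ≤ ε / 2 * √d := by
    calc _ = F.N * √d * √d := by rw [mul_assoc, Real.mul_self_sqrt hd0]
      _ ≤ _ := by gcongr
  linarith [abs_sub_le (ψ A') (ψ B) (ψ A)]

end Frame

end Abstract

lemma norm_le_enormP {d e : ℕ} (P : (Fin d → ℝ) × (Fin e → ℝ)) : ‖P‖ ≤ enormP P := by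
  have h₁ : 0 ≤ ∑ i, P.1 i ^ 2 := Finset.sum_nonneg fun i _ => sq_nonneg _
  have h₂ : 0 ≤ ∑ s, P.2 s ^ 2 := Finset.sum_nonneg fun i _ => sq_nonneg _
  refine max_le ((pi_norm_le_iff_of_nonneg (Real.sqrt_nonneg _)).2 fun i => ?_)
    ((pi_norm_le_iff_of_nonneg (Real.sqrt_nonneg _)).2 fun s => ?_)
  · refine Real.abs_le_sqrt ?_
    have := Finset.single_le_sum (fun j _ => sq_nonneg (P.1 j)) (Finset.mem_univ i)
    linarith
  · refine Real.abs_le_sqrt ?_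
    have := Finset.single_le_sum (fun j _ => sq_nonneg (P.2 j)) (Finset.mem_univ s)
    linarith

lemma enormP_le {d e : ℕ} (P : (Fin d → ℝ) × (Fin e → ℝ)) : enormP P ≤ √(d + e) * ‖P‖ := by
  rw [enormP]
  refine Real.sqrt_le_iff.2 ⟨by positivity, ?_⟩
  rw [mul_pow, Real.sq_sqrt (by positivity), add_mul]
  have h₁ : ∑ i, P.1 i ^ 2 ≤ ∑ _i : Fin d, ‖P‖ ^ 2 := Finset.sum_le_sum fun i _ =>
    sq_le_sq' (neg_le_of_abs_le ((norm_le_pi_norm P.1 i).trans (norm_fst_le P)))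
      (le_of_abs_le ((norm_le_pi_norm P.1 i).trans (norm_fst_le P)))
  have h₂ : ∑ i, P.2 i ^ 2 ≤ ∑ _i : Fin e, ‖P‖ ^ 2 := Finset.sum_le_sum fun i _ =>
    sq_le_sq' (neg_le_of_abs_le ((norm_le_pi_norm P.2 i).trans (norm_snd_le P)))
      (le_of_abs_le ((norm_le_pi_norm P.2 i).trans (norm_snd_le P)))
  simp only [Finset.sum_const, Finset.card_univ, Fintype.card_fin, nsmul_eq_mul] at h₁ h₂
  linarith

lemma abs_sum_mul_le {d : ℕ} (ζ a : Fin d → ℝ) {c : ℝ} (ha : ∀ j, |a j| ≤ c) :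
    |∑ j, ζ j * a j| ≤ d * c * ‖ζ‖ := by
  refine (Finset.abs_sum_le_sum_abs _ _).trans ?_
  have : ∑ j, |ζ j * a j| ≤ ∑ _j : Fin d, ‖ζ‖ * c := Finset.sum_le_sum fun j _ => by
    rw [abs_mul]
    exact mul_le_mul (norm_le_pi_norm ζ j) (ha j) (abs_nonneg _) (norm_nonneg _)
  refine this.trans_eq ?_
  rw [Finset.sum_const, Finset.card_univ, Fintype.card_fin, nsmul_eq_mul]
  ring

section Coefficients

variable {m n : ℕ} (h0 : 0 < m) (b : Fin n → Matrix (Fin m) (Fin m) ℝ)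

/-- The vertical part of `D_j^ψ` that multiplies `ψ`, extended linearly in the direction. -/
def vertV : (Fin (m - 1) → ℝ) →L[ℝ] (Fin n → ℝ) :=
  ∑ j, (ContinuousLinearMap.proj (R := ℝ) (φ := fun _ => ℝ) j).smulRight
    fun s => b s (idx1 m j) ⟨0, h0⟩

/-- The vertical part of `D_j^ψ` that does not involve `ψ`, extended linearly in the direction. -/
def vertU : (Fin (m - 1) → ℝ) →L[ℝ] (Fin (m - 1) → ℝ) →L[ℝ] (Fin n → ℝ) :=
  ∑ j, ∑ l, (ContinuousLinearMap.proj (R := ℝ) (φ := fun _ => ℝ) l).smulRight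
    ((ContinuousLinearMap.proj (R := ℝ) (φ := fun _ => ℝ) j).smulRight
      fun s => 1 / 2 * b s (idx1 m j) (idx1 m l))

lemma vertV_apply (ζ : Fin (m - 1) → ℝ) (s : Fin n) :
    vertV h0 b ζ s = ∑ j, ζ j * b s (idx1 m j) ⟨0, h0⟩ := by
  simp [vertV]

lemma vertU_apply (x ζ : Fin (m - 1) → ℝ) (s : Fin n) :
    vertU b x ζ s = ∑ j, ∑ l, x l * (ζ j * (1 / 2 * b s (idx1 m j) (idx1 m l))) := by
  simp [vertU]

lemma vertU_skew (hskew : ∀ s, (b s).transpose = -(b s)) (x ζ : Fin (m - 1) → ℝ) :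
    vertU b x ζ = -vertU b ζ x := by
  ext s
  rw [Pi.neg_apply, vertU_apply, vertU_apply, Finset.sum_comm, ← Finset.sum_neg_distrib]
  refine Finset.sum_congr rfl fun l _ => ?_
  rw [← Finset.sum_neg_distrib]
  refine Finset.sum_congr rfl fun j _ => ?_
  have : b s (idx1 m j) (idx1 m l) = -b s (idx1 m l) (idx1 m j) := congrFun₂ (hskew s) _ _
  rw [this]
  ring

lemma fderiv_eq_sum_Dj (ψ : W m n 1 → ℝ) (ζ : Fin (m - 1) → ℝ) (A : W m n 1) :
    fderiv ℝ ψ A (ζ, ψ A • vertV h0 b ζ + vertU b A.1 ζ) = ∑ j, ζ j * Dj m n h0 b ψ j A := by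
  have hw : ∀ s, (ψ A • vertV h0 b ζ + vertU b A.1 ζ) s =
      ∑ j, ζ j * (ψ A * b s (idx1 m j) ⟨0, h0⟩ +
        (1 / 2) * ∑ l, A.1 l * b s (idx1 m j) (idx1 m l)) := fun s => by
    rw [Pi.add_apply, Pi.smul_apply, vertV_apply, vertU_apply, smul_eq_mul, Finset.mul_sum,
      ← Finset.sum_add_distrib]
    refine Finset.sum_congr rfl fun j _ => ?_
    rw [mul_add, Finset.mul_sum, Finset.mul_sum]
    congr 1
    · ring
    · exact Finset.sum_congr rfl fun l _ => by ring
  have h : (ζ, ψ A • vertV h0 b ζ + vertU b A.1 ζ) =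
      ∑ j, ζ j • ((Pi.single j 1 : Fin (m - 1) → ℝ), (0 : Fin n → ℝ)) +
      ∑ s, (ψ A • vertV h0 b ζ + vertU b A.1 ζ) s •
          ((0 : Fin (m - 1) → ℝ), (Pi.single s 1 : Fin n → ℝ)) := by
    ext <;> simp [Prod.fst_sum, Prod.snd_sum, Pi.single_apply]
  rw [h, map_add, map_sum, map_sum]
  simp only [map_smul, smul_eq_mul, Dj, hw, Finset.sum_mul]
  rw [Finset.sum_comm (s := Finset.univ (α := Fin n)), ← Finset.sum_add_distrib]
  refine Finset.sum_congr rfl fun j _ => ?_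
  rw [mul_add, Finset.mul_sum]
  exact congrArg₂ _ rfl (Finset.sum_congr rfl fun s _ => mul_assoc _ _ _)

lemma eq_top_of_vert_mem (hskew : ∀ s, (b s).transpose = -(b s)) (hind : LinearIndependent ℝ b)
    (p : Submodule ℝ (Fin n → ℝ)) (hV : ∀ j, vertV h0 b (Pi.single j 1) ∈ p)
    (hU : ∀ j l, vertU b (Pi.single l 1) (Pi.single j 1) ∈ p) : p = ⊤ := by
  by_contra hp
  obtain ⟨f, hf, hfp⟩ := p.exists_le_ker_of_lt_top (lt_top_iff_ne_top.2 hp)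
  have hfs : ∀ y, f y = ∑ s, f (Pi.single s 1) * y s := fun y => by
    rw [LinearMap.pi_apply_eq_sum_univ f y]
    refine Finset.sum_congr rfl fun s _ => ?_
    rw [smul_eq_mul, mul_comm]
    congr 2
    ext t
    simp [Pi.single_apply, eq_comm]
  have hdiag : ∀ s i, b s i i = 0 := fun s i => by
    have : b s i i = -b s i i := congrFun₂ (hskew s) i i
    linarith
  have hcol : ∀ j, ∑ s, f (Pi.single s 1) * b s (idx1 m j) ⟨0, h0⟩ = 0 := fun j => by
    have := LinearMap.mem_ker.1 (hfp (hV j))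
    rw [hfs] at this
    simpa [vertV_apply, Pi.single_apply] using this
  have hblock : ∀ j l, ∑ s, f (Pi.single s 1) * b s (idx1 m j) (idx1 m l) = 0 := fun j l => by
    have := LinearMap.mem_ker.1 (hfp (hU j l))
    rw [hfs] at this
    simp only [vertU_apply, Pi.single_apply, ite_mul, one_mul, zero_mul, Finset.sum_ite_eq',
      Finset.mem_univ, if_true] at this
    rw [← mul_right_inj' (show (1 / 2 : ℝ) ≠ 0 by norm_num), mul_zero, ← this, Finset.mul_sum]
    exact Finset.sum_congr rfl fun s _ => by ring
  have hidx : ∀ i : Fin m, i = ⟨0, h0⟩ ∨ ∃ j, i = idx1 m j := fun i => by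
    rcases Nat.eq_zero_or_pos i with hi | hi
    · exact .inl (Fin.ext hi)
    · exact .inr ⟨⟨i - 1, by omega⟩, Fin.ext (by simp only [idx1]; omega)⟩
  have hsum : ∑ s, f (Pi.single s 1) • b s = 0 := by
    ext i k
    rw [Matrix.sum_apply]
    simp only [Matrix.smul_apply, smul_eq_mul, Matrix.zero_apply]
    rcases hidx k with rfl | ⟨l, rfl⟩
    · rcases hidx i with rfl | ⟨j, rfl⟩
      · simp [hdiag]
      · exact hcol j
    · rcases hidx i with rfl | ⟨j, rfl⟩
      · rw [← neg_eq_zero, ← Finset.sum_neg_distrib, ← hcol l]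
        refine Finset.sum_congr rfl fun s _ => ?_
        have : b s (idx1 m l) ⟨0, h0⟩ = -b s ⟨0, h0⟩ (idx1 m l) := congrFun₂ (hskew s) _ _
        rw [this, mul_neg]
      · exact hblock j l
  refine hf (LinearMap.ext fun y => ?_)
  rw [hfs]
  simp [Fintype.linearIndependent_iff.1 hind _ hsum]

end Coefficients

/-- The hypotheses on `ψ` in the uniform little-Hölder estimate. -/
structure Bounded (m n : ℕ) (h0 : 0 < m) (b : Fin n → Matrix (Fin m) (Fin m) ℝ)
    (Ω : Set (W m n 1)) (M N₀ : ℝ) (β : ℝ → ℝ) (ψ : W m n 1 → ℝ) : Prop where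
  contDiffOn : ContDiffOn ℝ 1 ψ Ω
  abs_apply_le : ∀ A ∈ Ω, |ψ A| ≤ M
  abs_Dj_le : ∀ j : Fin (m - 1), ∀ A ∈ Ω, |Dj m n h0 b ψ j A| ≤ N₀
  abs_Dj_sub_le : ∀ j : Fin (m - 1), ∀ A ∈ Ω, ∀ A' ∈ Ω,
    |Dj m n h0 b ψ j A - Dj m n h0 b ψ j A'| ≤ β (enormP (A - A'))

section Estimate

variable {m n : ℕ} {h0 : 0 < m} {b : Fin n → Matrix (Fin m) (Fin m) ℝ} {Ω : Set (W m n 1)}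
  {M N₀ : ℝ} {β : ℝ → ℝ}

lemma exists_frame (hm : 2 ≤ m) (hskew : ∀ s, (b s).transpose = -(b s)) (hΩ : IsOpen Ω)
    (hΩc : IsCompact (closure Ω)) (hM : 0 ≤ M) (hN : 0 ≤ N₀) (hβ0 : ∀ r, 0 ≤ β r)
    (hβmono : ∀ r r' : ℝ, 0 < r → r ≤ r' → β r ≤ β r')
    (hβlim : Tendsto β (𝓝[>] (0 : ℝ)) (𝓝 0)) :
    ∃ F : Frame (Fin (m - 1) → ℝ) (Fin n → ℝ), F.V = vertV h0 b ∧ F.U = vertU b ∧ F.Ω = Ω ∧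
      ∀ ψ, Bounded m n h0 b Ω M N₀ β ψ → F.Adm ψ := by
  obtain ⟨R, hR⟩ := hΩc.isBounded.exists_norm_le
  have hC : 0 < √(((m - 1 : ℕ) : ℝ) + n) := Real.sqrt_pos.2 (by
    have : (0 : ℝ) < ((m - 1 : ℕ) : ℝ) := by exact_mod_cast (by omega : 0 < m - 1)
    positivity)
  set C := √(((m - 1 : ℕ) : ℝ) + n) with hCdef
  let F : Frame (Fin (m - 1) → ℝ) (Fin n → ℝ) :=
    { V := vertV h0 b
      U := vertU b
      Ω := Ω
      M := M
      N := (m - 1 : ℕ) * N₀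
      K := 1 + M * ‖vertV h0 b‖ + ‖vertU b‖ * |R|
      ω := fun r => (m - 1 : ℕ) * β (C * r)
      skew := vertU_skew b hskew
      isOpen := hΩ
      M_nonneg := hM
      N_nonneg := by positivity
      one_le_K := by
        have h₁ : 0 ≤ M * ‖vertV h0 b‖ := by positivity
        have h₂ : 0 ≤ ‖vertU b‖ * |R| := by positivity
        linarith
      speed_le := fun A hA ζ hζ => by
        have h₁ : ‖vertV h0 b ζ‖ ≤ ‖vertV h0 b‖ :=
          (vertV h0 b).le_of_opNorm_le_of_le le_rfl hζ |>.trans_eq (mul_one _)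
        have h₂ : ‖vertU b A.1 ζ‖ ≤ ‖vertU b‖ * |R| := by
          refine ((vertU b A.1).le_of_opNorm_le_of_le le_rfl hζ).trans ?_
          rw [mul_one]
          exact (vertU b).le_of_opNorm_le_of_le le_rfl
            ((norm_fst_le A).trans ((hR A (subset_closure hA)).trans (le_abs_self R)))
        have h₃ := mul_le_mul_of_nonneg_left h₁ hM
        linarith
      ω_nonneg := fun r => mul_nonneg (Nat.cast_nonneg _) (hβ0 _)
      tendsto := by
        have h₁ : Tendsto (fun r : ℝ => C * r) (𝓝[>] 0) (𝓝[>] 0) := by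
          refine tendsto_nhdsWithin_iff.2 ⟨?_, ?_⟩
          · have : Tendsto (fun r : ℝ => C * r) (𝓝 0) (𝓝 0) := by
              simpa using (continuous_const_mul C).tendsto 0
            exact this.mono_left nhdsWithin_le_nhds
          · filter_upwards [self_mem_nhdsWithin] with r hr
            exact mul_pos hC hr
        simpa using (hβlim.comp h₁).const_mul ((m - 1 : ℕ) : ℝ) }
  have hF : ∀ ψ ζ A, F.ideriv ψ ζ A = ∑ j, ζ j * Dj m n h0 b ψ j A :=
    fderiv_eq_sum_Dj h0 b
  refine ⟨F, rfl, rfl, rfl, fun ψ hψ => ⟨hψ.contDiffOn, hψ.abs_apply_le, fun ζ A hA => ?_,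
    fun ζ A hA A' hA' r hr hd => ?_⟩⟩
  · rw [hF]
    exact abs_sum_mul_le ζ _ fun j => hψ.abs_Dj_le j A hA
  · rw [hF, hF, ← Finset.sum_sub_distrib]
    simp only [← mul_sub]
    refine abs_sum_mul_le ζ _ fun j => ?_
    rcases eq_or_ne A A' with rfl | hne
    · rw [sub_self, abs_zero]
      exact hβ0 _
    · refine (hψ.abs_Dj_sub_le j A hA A' hA').trans (hβmono _ _ ?_ ?_)
      · exact (norm_pos_iff.2 (sub_ne_zero.2 hne)).trans_le (norm_le_enormP _)
      · exact (enormP_le _).trans (mul_le_mul_of_nonneg_left hd hC.le)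

lemma exists_forall_abs_sub_le (hm : 2 ≤ m) (hskew : ∀ s, (b s).transpose = -(b s))
    (hind : LinearIndependent ℝ b) (hΩ : IsOpen Ω)
    (hΩc : IsCompact (closure Ω)) (hM : 0 ≤ M) (hN : 0 ≤ N₀) (hβ0 : ∀ r, 0 ≤ β r)
    (hβmono : ∀ r r' : ℝ, 0 < r → r ≤ r' → β r ≤ β r')
    (hβlim : Tendsto β (𝓝[>] (0 : ℝ)) (𝓝 0)) {S : Set (W m n 1)} (hS : IsCompact (closure S))
    (hSΩ : closure S ⊆ Ω) {ε : ℝ} (hε : 0 < ε) :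
    ∃ ρ > 0, ∀ ψ, Bounded m n h0 b Ω M N₀ β ψ → ∀ A ∈ S, ∀ A' ∈ S, enormP (A - A') ≤ ρ →
      |ψ A - ψ A'| ≤ ε * √(enormP (A - A')) := by
  obtain ⟨F, hV, hU, rfl, hF⟩ := exists_frame (h0 := h0) hm hskew hΩ hΩc hM hN hβ0 hβmono hβlim
  have hsingle : ∀ j : Fin (m - 1), ‖(Pi.single j 1 : Fin (m - 1) → ℝ)‖ ≤ 1 := fun j => by
    rw [Pi.norm_single, norm_one]
  have htop : F.littleHolderSubmodule = ⊤ := eq_top_of_vert_mem h0 b hskew hind _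
    (fun j => hV ▸ Frame.littleHolder_V (hsingle j))
    (fun j l => hU ▸ Frame.littleHolder_U (hsingle l) (hsingle j))
  obtain ⟨δ, hδ, hδΩ⟩ := hS.exists_cthickening_subset_open hΩ hSΩ
  obtain ⟨ρ, hρ, h⟩ := Frame.exists_forall_sub_le (F := F)
    (fun w => htop.ge (Submodule.mem_top (x := w))) hδ hε
  refine ⟨ρ, hρ, fun ψ hψ A hA A' hA' hd => ?_⟩
  have hle := norm_le_enormP (A - A')
  have h₁ := h ψ (hF ψ hψ) A' A ((Metric.closedBall_subset_cthickening (subset_closure hA') δ).trans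
    hδΩ) (hle.trans hd)
  exact h₁.trans (mul_le_mul_of_nonneg_left (Real.sqrt_le_sqrt hle) hε.le)

end Estimate

/-- A uniform bound `o(√r)` for a family of quantities is realised by a single modulus. -/
lemma exists_modulus {P : ℝ → ℝ → Prop} {C : ℝ} (hP : ∀ r q, P r q → 0 ≤ q ∧ q ≤ C)
    (hlim : ∀ ε > 0, ∃ ρ > 0, ∀ r q, P r q → r ≤ ρ → q ≤ ε * √r) :
    ∃ α : ℝ → ℝ, (∀ r, 0 ≤ α r) ∧ Tendsto α (𝓝[>] 0) (𝓝 0) ∧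
      ∀ r q, 0 < r → P r q → q ≤ α r * √r := by
  have h0 : ∀ r, 0 ≤ sSup {a | ∃ q, P r q ∧ a = q / √r} := fun r => by
    refine Real.sSup_nonneg ?_
    rintro _ ⟨q, hq, rfl⟩
    exact div_nonneg (hP r q hq).1 (Real.sqrt_nonneg r)
  refine ⟨_, h0, Metric.tendsto_nhds.2 fun ε hε => ?_, fun r q hr hq => ?_⟩
  · obtain ⟨ρ, hρ, h⟩ := hlim (ε / 2) (by positivity)
    filter_upwards [Ioc_mem_nhdsGT hρ] with r hr
    rw [Real.dist_eq, sub_zero, abs_of_nonneg (h0 r)]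
    refine (Real.sSup_le ?_ (by positivity)).trans_lt (half_lt_self hε)
    rintro _ ⟨q, hq, rfl⟩
    exact (div_le_iff₀ (Real.sqrt_pos.2 hr.1)).2 (h r q hq hr.2)
  · rw [← div_le_iff₀ (Real.sqrt_pos.2 hr)]
    refine le_csSup ⟨C / √r, ?_⟩ ⟨q, hq, rfl⟩
    rintro _ ⟨q', hq', rfl⟩
    exact div_le_div_of_nonneg_right (hP r q' hq').2 (Real.sqrt_nonneg r)

/-- Uniform little-Hölder estimate: given `𝒪' ⋐ 𝒪'' ⋐ 𝒪`, bounds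
`M, N₀` and a modulus of continuity `β`, there is a single modulus `α` (with
`α(r) → 0` as `r → 0⁺`) such that every `ψ ∈ C¹(𝒪)` with `sup_{𝒪''}|ψ| ≤ M`,
`sup_{𝒪''}|D_j^ψψ| ≤ N₀` and modulus of continuity `β` for each `D_j^ψψ` on `𝒪''`
satisfies `|ψ(A) − ψ(A')| ≤ α(|A − A'|)·|A − A'|^{1/2}` on `𝒪'`. -/
theorem statement14 (m n : ℕ) (hm : 2 ≤ m) (hn : 1 ≤ n)
    (b : Fin n → Matrix (Fin m) (Fin m) ℝ)
    (hskew : ∀ s, (b s).transpose = -(b s)) (hind : LinearIndependent ℝ b)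
    (O O' O'' : Set (W m n 1)) (hO : IsOpen O) (hO' : IsOpen O') (hO'' : IsOpen O'')
    (h1 : IsCompact (closure O')) (h2 : closure O' ⊆ O'')
    (h3 : IsCompact (closure O'')) (h4 : closure O'' ⊆ O)
    (M N₀ : ℝ) (hM : 0 < M) (hN : 0 < N₀)
    (β : ℝ → ℝ) (hβ0 : ∀ r, 0 ≤ β r)
    (hβmono : ∀ r r' : ℝ, 0 < r → r ≤ r' → β r ≤ β r')
    (hβlim : Filter.Tendsto β (𝓝[>] (0:ℝ)) (𝓝 0)) :
    ∃ α : ℝ → ℝ, (∀ r, 0 ≤ α r) ∧ Filter.Tendsto α (𝓝[>] (0:ℝ)) (𝓝 0) ∧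
      ∀ ψ : W m n 1 → ℝ, ContDiffOn ℝ 1 ψ O →
        (∀ A ∈ O'', |ψ A| ≤ M) →
        (∀ j : Fin (m - 1), ∀ A ∈ O'', |Dj m n (by omega) b ψ j A| ≤ N₀) →
        (∀ j : Fin (m - 1), ∀ A ∈ O'', ∀ A' ∈ O'',
          |Dj m n (by omega) b ψ j A - Dj m n (by omega) b ψ j A'| ≤ β (enormP (A - A'))) →
        ∀ A ∈ O', ∀ A' ∈ O', A ≠ A' →
          |ψ A - ψ A'| ≤ α (enormP (A - A')) * Real.sqrt (enormP (A - A')) := by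
  obtain ⟨α, hα0, hα, h⟩ := exists_modulus (C := 2 * M)
    (P := fun r q => ∃ ψ A A', Bounded m n (by omega) b O'' M N₀ β ψ ∧ A ∈ O' ∧ A' ∈ O' ∧
      enormP (A - A') = r ∧ |ψ A - ψ A'| = q) (by
    rintro _ _ ⟨ψ, A, A', hψ, hA, hA', rfl, rfl⟩
    have k₁ := hψ.abs_apply_le A (h2 (subset_closure hA))
    have k₂ := hψ.abs_apply_le A' (h2 (subset_closure hA'))
    exact ⟨abs_nonneg _, by linarith [abs_sub (ψ A) (ψ A')]⟩) (fun ε hε => by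
    obtain ⟨ρ, hρ, h⟩ := exists_forall_abs_sub_le (h0 := by omega) hm hskew hind hO'' h3 hM.le
      hN.le hβ0 hβmono hβlim h1 h2 hε
    refine ⟨ρ, hρ, ?_⟩
    rintro _ _ ⟨ψ, A, A', hψ, hA, hA', rfl, rfl⟩ hr
    exact h ψ hψ A hA A' hA' hr)
  refine ⟨α, hα0, hα, fun ψ hψ hψM hψN hψβ A hA A' hA' hne => h _ _ ?_
    ⟨ψ, A, A', ⟨hψ.mono (subset_closure.trans h4), hψM, hψN, hψβ⟩, hA, hA', rfl, rfl⟩⟩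
  exact (norm_pos_iff.2 (sub_ne_zero.2 hne)).trans_le (norm_le_enormP _)

end Carnot
end
end
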